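/- Let (Ω, F, P) be a nonatomic probability space and let ρ : L∞₊₊ → (0,∞) be a law-invariant, geometrically convex return risk measure with the CxLS property. Then there exists a GA-convex Orlicz function Φ : (0,∞) → ℝ ∪ {+∞} such that ρ(X) = H_Φ(X) := inf{k > 0 : E[Φ(X/k)] ≤ 1} for every X ∈ L∞₊₊. -/

import Mathlib

open MeasureTheory Filter Set
open scoped ENNReal

noncomputable section

variable {Ω : Type*} [MeasurableSpace Ω]

/-- `X` belongs to `L^∞_+(P)`: it is measurable, `P`-a.s. nonnegative and
`P`-essentially bounded. -/
def MemLinftyPlus (P : Measure Ω) (X : Ω → ℝ) : Prop :=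
  Measurable X ∧ (∀ᵐ ω ∂P, 0 ≤ X ω) ∧ ∃ C : ℝ, ∀ᵐ ω ∂P, X ω ≤ C

/-- `X` belongs to `L^∞_++(P)`: it is measurable, bounded away from `0` and
`P`-essentially bounded. -/
def MemLinftyPlusPlus (P : Measure Ω) (X : Ω → ℝ) : Prop :=
  Measurable X ∧ (∃ c : ℝ, 0 < c ∧ ∀ᵐ ω ∂P, c ≤ X ω) ∧ ∃ C : ℝ, ∀ᵐ ω ∂P, X ω ≤ C

/-- An Orlicz function `Φ : [0,∞) → ℝ ∪ {±∞}`: nondecreasing, left-continuous,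
`Φ(x) > -∞` for `x > 0`, `Φ(x) ≤ 1` for `0 ≤ x ≤ 1` and `Φ(x) > 1` for `x > 1`. -/
structure IsOrliczFunction (Φ : ℝ → EReal) : Prop where
  ne_bot : ∀ x : ℝ, 0 < x → Φ x ≠ ⊥
  le_one : ∀ x : ℝ, 0 ≤ x → x ≤ 1 → Φ x ≤ 1
  one_lt : ∀ x : ℝ, 1 < x → 1 < Φ x
  mono : ∀ x y : ℝ, 0 ≤ x → x ≤ y → Φ x ≤ Φ y
  left_cont : ∀ x : ℝ, 0 < x → Φ x = ⨆ y : Set.Ico (0 : ℝ) x, Φ (y : ℝ)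

/-- The nonnegative part of an extended real, as an extended nonnegative real. -/
def erealToENNReal (x : EReal) : ℝ≥0∞ :=
  if x = ⊤ then ⊤ else ENNReal.ofReal x.toReal

/-- Expectation of an extended-real-valued function: positive part minus negative part. -/
def eexp (P : Measure Ω) (f : Ω → EReal) : EReal :=
  ((∫⁻ ω, erealToENNReal (f ω) ∂P : ℝ≥0∞) : EReal)
    - ((∫⁻ ω, erealToENNReal (-(f ω)) ∂P : ℝ≥0∞) : EReal)

/-- The (generalized) Orlicz premium `H_Φ(X) = inf {k > 0 | E[Φ(X/k)] ≤ 1}`, with the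
convention `H_Φ(X) = 0` if `Φ(0) = -∞` and `P(X = 0) > 0`. -/
def orliczPremium (P : Measure Ω) (Φ : ℝ → EReal) (X : Ω → ℝ) : ℝ :=
  if Φ 0 = ⊥ ∧ 0 < P {ω | X ω = 0} then 0
  else sInf {k : ℝ | 0 < k ∧ eexp P (fun ω => Φ (X ω / k)) ≤ 1}

/-- Addition on `EReal` with the convention `(-∞) + (+∞) = +∞`. -/
def eadd (a b : EReal) : EReal :=
  if (a = ⊥ ∧ b = ⊤) ∨ (a = ⊤ ∧ b = ⊥) then ⊤ else a + b

/-- Multiplication on `ℝ≥0∞` with the convention `0 * ∞ = ∞`. -/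
def gmulE (a b : ℝ≥0∞) : ℝ≥0∞ :=
  if (a = 0 ∧ b = ⊤) ∨ (a = ⊤ ∧ b = 0) then ⊤ else a * b


namespace OrliczAux

set_option linter.unusedSectionVars false

/-- Essentially bounded measurable random variables. -/
def Bd (P : Measure Ω) (X : Ω → ℝ) : Prop :=
  Measurable X ∧ ∃ K : ℝ, ∀ᵐ ω ∂P, |X ω| ≤ K

/-- The logarithmic version of the risk measure: a law-invariant convex monetary risk measure. -/
structure PsiData (P : Measure Ω) (ψ : (Ω → ℝ) → ℝ) : Prop where
  real : ∀ μ : Measure ℝ, IsProbabilityMeasure μ → ∃ X : Ω → ℝ, Measurable X ∧ P.map X = μ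
  mono : ∀ X Y : Ω → ℝ, Bd P X → Bd P Y → (∀ᵐ ω ∂P, X ω ≤ Y ω) → ψ X ≤ ψ Y
  cash : ∀ X : Ω → ℝ, Bd P X → ∀ c : ℝ, ψ (fun ω => X ω + c) = ψ X + c
  zero : ψ (fun _ => 0) = 0
  law : ∀ X Y : Ω → ℝ, Bd P X → Bd P Y → P.map X = P.map Y → ψ X = ψ Y
  conv : ∀ X Y : Ω → ℝ, Bd P X → Bd P Y → ∀ l ∈ Set.Ioo (0 : ℝ) 1,
    ψ (fun ω => l * X ω + (1 - l) * Y ω) ≤ l * ψ X + (1 - l) * ψ Y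
  cx : ∀ X Y Z : Ω → ℝ, Bd P X → Bd P Y → Bd P Z → ∀ γ : ℝ, ψ X = γ → ψ Y = γ →
    ∀ l ∈ Set.Ioo (0 : ℝ) 1,
      P.map Z = ENNReal.ofReal l • P.map X + ENNReal.ofReal (1 - l) • P.map Y → ψ Z = γ

section basic

variable {P : Measure Ω} [IsProbabilityMeasure P] {ψ : (Ω → ℝ) → ℝ}

lemma bd_const (c : ℝ) : Bd P (fun _ => c) :=
  ⟨measurable_const, |c|, Eventually.of_forall fun _ => le_rfl⟩

lemma bd_add {X Y : Ω → ℝ} (hX : Bd P X) (hY : Bd P Y) : Bd P (fun ω => X ω + Y ω) := by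
  obtain ⟨hm, K, hK⟩ := hX
  obtain ⟨hm', K', hK'⟩ := hY
  refine ⟨hm.add hm', K + K', ?_⟩
  filter_upwards [hK, hK'] with ω h1 h2
  exact (abs_add_le _ _).trans (add_le_add h1 h2)

lemma bd_mul {X : Ω → ℝ} (c : ℝ) (hX : Bd P X) : Bd P (fun ω => c * X ω) := by
  obtain ⟨hm, K, hK⟩ := hX
  refine ⟨hm.const_mul c, |c| * K, ?_⟩
  filter_upwards [hK] with ω h1
  rw [abs_mul]
  exact mul_le_mul_of_nonneg_left h1 (abs_nonneg _)

/-- boundedness only depends on the law -/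
lemma bd_of_law {X : Ω → ℝ} (hX : Measurable X) {K : ℝ}
    (h : ∀ᵐ t ∂(P.map X), |t| ≤ K) : Bd P X := by
  refine ⟨hX, K, ?_⟩
  exact (ae_map_iff hX.aemeasurable (measurableSet_le measurable_norm measurable_const)).1 h

lemma law_of_bd {X : Ω → ℝ} (hX : Bd P X) : ∃ K, ∀ᵐ t ∂(P.map X), |t| ≤ K := by
  obtain ⟨hm, K, hK⟩ := hX
  exact ⟨K, (ae_map_iff hm.aemeasurable (measurableSet_le measurable_norm measurable_const)).2 hK⟩

lemma PsiData.const (h : PsiData P ψ) (c : ℝ) : ψ (fun _ => c) = c := by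
  have := h.cash (fun _ => 0) (bd_const 0) c
  simpa [h.zero] using this

lemma PsiData.convexOn (h : PsiData P ψ) : ConvexOn ℝ {X | Bd P X} ψ := by
  refine ⟨?_, ?_⟩
  · intro X hX Y hY a b _ _ _
    exact bd_add (bd_mul a hX) (bd_mul b hY)
  · intro X hX Y hY a b ha hb hab
    rcases ha.eq_or_lt with rfl | ha
    · have : b = 1 := by linarith
      subst this; simp
    rcases hb.eq_or_lt with rfl | hb
    · have : a = 1 := by linarith
      subst this; simp
    have := h.conv X Y hX hY a ⟨ha, by linarith⟩
    have e : 1 - a = b := by linarith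
    rw [e] at this
    exact this

lemma PsiData.realize (h : PsiData P ψ) {α : Type} [MeasurableSpace α] [StandardBorelSpace α]
    [Nonempty α] (μ : Measure α) [IsProbabilityMeasure μ] :
    ∃ W : Ω → α, Measurable W ∧ P.map W = μ := by
  obtain ⟨f, hf⟩ := exists_measurableEmbedding_real α
  obtain ⟨g, hg, hgf⟩ := hf.exists_measurable_extend (measurable_id (α := α)) (fun _ => inferInstance)
  have : IsProbabilityMeasure (μ.map f) := Measure.isProbabilityMeasure_map hf.measurable.aemeasurable
  obtain ⟨X, hX, hXl⟩ := h.real (μ.map f) this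
  refine ⟨g ∘ X, hg.comp hX, ?_⟩
  rw [← Measure.map_map hg hX, hXl, Measure.map_map hg hf.measurable, hgf, Measure.map_id]

/-- `μ` is (a positive multiple of) a law with nonpositive risk. -/
def Neg (P : Measure Ω) (ψ : (Ω → ℝ) → ℝ) (μ : Measure ℝ) : Prop :=
  ∃ X, Bd P X ∧ ∃ c : ℝ, 0 < c ∧ μ = ENNReal.ofReal c • P.map X ∧ ψ X ≤ 0

/-- `μ` is (a positive multiple of) a law with positive risk. -/
def Pos (P : Measure Ω) (ψ : (Ω → ℝ) → ℝ) (μ : Measure ℝ) : Prop :=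
  ∃ X, Bd P X ∧ ∃ c : ℝ, 0 < c ∧ μ = ENNReal.ofReal c • P.map X ∧ 0 < ψ X

lemma smul_law_eq {X Y : Ω → ℝ} (hX : Measurable X) (hY : Measurable Y) {c d : ℝ} (hc : 0 < c)
    (hd : 0 < d) (h : ENNReal.ofReal c • P.map X = ENNReal.ofReal d • P.map Y) :
    c = d ∧ P.map X = P.map Y := by
  have hpX : IsProbabilityMeasure (P.map X) := Measure.isProbabilityMeasure_map hX.aemeasurable
  have hpY : IsProbabilityMeasure (P.map Y) := Measure.isProbabilityMeasure_map hY.aemeasurable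
  have h1 : ENNReal.ofReal c = ENNReal.ofReal d := by
    have := congrArg (fun m : Measure ℝ => m Set.univ) h
    simpa using this
  have h2 : c = d := (ENNReal.ofReal_eq_ofReal_iff hc.le hd.le).1 h1
  subst h2
  refine ⟨rfl, ?_⟩
  ext s hs
  have := congrArg (fun m : Measure ℝ => m s) h
  simp only [Measure.smul_apply, smul_eq_mul] at this
  exact (ENNReal.mul_right_inj (by simpa using hc) ENNReal.ofReal_ne_top).1 this

lemma PsiData.not_neg_pos (h : PsiData P ψ) {μ : Measure ℝ} (h1 : Neg P ψ μ) (h2 : Pos P ψ μ) :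
    False := by
  obtain ⟨X, hX, c, hc, hμ, hψ⟩ := h1
  obtain ⟨Y, hY, d, hd, hμ', hψ'⟩ := h2
  have := smul_law_eq hX.1 hY.1 hc hd (hμ.symm.trans hμ')
  have := h.law X Y hX hY this.2
  linarith

lemma Neg.smul {μ : Measure ℝ} (h : Neg P ψ μ) {c : ℝ} (hc : 0 < c) :
    Neg P ψ (ENNReal.ofReal c • μ) := by
  obtain ⟨X, hX, d, hd, rfl, hψ⟩ := h
  refine ⟨X, hX, c * d, by positivity, ?_, hψ⟩
  rw [smul_smul, ENNReal.ofReal_mul hc.le]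

lemma Pos.smul {μ : Measure ℝ} (h : Pos P ψ μ) {c : ℝ} (hc : 0 < c) :
    Pos P ψ (ENNReal.ofReal c • μ) := by
  obtain ⟨X, hX, d, hd, rfl, hψ⟩ := h
  refine ⟨X, hX, c * d, by positivity, ?_, hψ⟩
  rw [smul_smul, ENNReal.ofReal_mul hc.le]

lemma PsiData.neg_or_pos (h : PsiData P ψ) {μ : Measure ℝ} [IsFiniteMeasure μ] (hμ : μ ≠ 0)
    {K : ℝ} (hK : ∀ᵐ t ∂μ, |t| ≤ K) : Neg P ψ μ ∨ Pos P ψ μ := by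
  have h0 : μ Set.univ ≠ 0 := by simpa using hμ
  have ht : μ Set.univ ≠ ⊤ := measure_ne_top _ _
  have : IsProbabilityMeasure ((μ Set.univ)⁻¹ • μ) :=
    ⟨by simp [ENNReal.inv_mul_cancel h0 ht]⟩
  obtain ⟨X, hX, hXl⟩ := h.real _ this
  have hB : Bd P X := by
    refine bd_of_law hX (K := K) ?_
    rw [hXl]
    exact Measure.ae_smul_measure hK _
  have e : μ = ENNReal.ofReal (μ Set.univ).toReal • P.map X := by
    rw [hXl, ENNReal.ofReal_toReal ht, smul_smul, ENNReal.mul_inv_cancel h0 ht, one_smul]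
  have hp : 0 < (μ Set.univ).toReal := ENNReal.toReal_pos h0 ht
  rcases le_or_gt (ψ X) 0 with h1 | h1
  · exact Or.inl ⟨X, hB, _, hp, e, h1⟩
  · exact Or.inr ⟨X, hB, _, hp, e, h1⟩

/-- mixing lemma -/
lemma PsiData.mix (h : PsiData P ψ) {X Y : Ω → ℝ} (hX : Bd P X) (hY : Bd P Y) {l : ℝ}
    (hl : l ∈ Set.Ioo (0 : ℝ) 1) :
    ∃ Z, Bd P Z ∧ P.map Z = ENNReal.ofReal l • P.map X + ENNReal.ofReal (1 - l) • P.map Y ∧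
      min (ψ X) (ψ Y) ≤ ψ Z ∧ ψ Z ≤ max (ψ X) (ψ Y) := by
  have hpX : IsProbabilityMeasure (P.map X) := Measure.isProbabilityMeasure_map hX.1.aemeasurable
  have hpY : IsProbabilityMeasure (P.map Y) := Measure.isProbabilityMeasure_map hY.1.aemeasurable
  set Q : Measure (ℝ × Bool) := ENNReal.ofReal l • (P.map X).map (fun t => (t, true)) +
    ENNReal.ofReal (1 - l) • (P.map Y).map (fun t => (t, false)) with hQ
  have mt : Measurable (fun t : ℝ => (t, true)) := by fun_prop
  have mf : Measurable (fun t : ℝ => (t, false)) := by fun_prop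
  have hsum : ENNReal.ofReal l + ENNReal.ofReal (1 - l) = 1 := by
    rw [← ENNReal.ofReal_add hl.1.le (by linarith [hl.2])]; simp
  have hQp : IsProbabilityMeasure Q := by
    have := Measure.isProbabilityMeasure_map (μ := P.map X) mt.aemeasurable
    have := Measure.isProbabilityMeasure_map (μ := P.map Y) mf.aemeasurable
    refine ⟨?_⟩
    rw [hQ]
    simp only [Measure.add_apply, Measure.smul_apply, measure_univ, smul_eq_mul, mul_one]
    exact hsum
  obtain ⟨W, hW, hWl⟩ := h.realize Q
  have hmapQ : ∀ f : ℝ × Bool → ℝ, Measurable f → P.map (fun ω => f (W ω)) =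
      ENNReal.ofReal l • P.map (fun ω => f (X ω, true)) +
        ENNReal.ofReal (1 - l) • P.map (fun ω => f (Y ω, false)) := by
    intro f hf
    have e1 : P.map (fun ω => f (W ω)) = Q.map f := by
      rw [← hWl, Measure.map_map hf hW]; rfl
    rw [e1, hQ, Measure.map_add _ _ hf, Measure.map_smul, Measure.map_smul,
      Measure.map_map hf mt, Measure.map_map hf mf, Measure.map_map (hf.comp mt) hX.1,
      Measure.map_map (hf.comp mf) hY.1]
    rfl
  set a := ψ X with ha
  set b := ψ Y with hb
  let s : Bool → ℝ := fun t => if t then a else b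
  have hs : Measurable s := measurable_of_finite s
  let Z : Ω → ℝ := fun ω => (W ω).1
  let Z' : Ω → ℝ := fun ω => (W ω).1 + (- s (W ω).2)
  have hZl := hmapQ (fun p => p.1) measurable_fst
  have hZ'l := hmapQ (fun p => p.1 + (- s p.2)) (by fun_prop)
  have hZ : Bd P Z := by
    obtain ⟨K, hK⟩ := law_of_bd hX
    obtain ⟨K', hK'⟩ := law_of_bd hY
    refine bd_of_law (K := max K K') hW.fst ?_
    change ∀ᵐ t ∂(P.map fun ω => (W ω).1), _
    rw [hZl, ae_add_measure_iff]
    constructor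
    · refine Measure.ae_smul_measure ?_ _
      filter_upwards [hK] with t ht using ht.trans (le_max_left _ _)
    · refine Measure.ae_smul_measure ?_ _
      filter_upwards [hK'] with t ht using ht.trans (le_max_right _ _)
  have hsb : Bd P (fun ω => - s (W ω).2) := by
    refine ⟨by fun_prop, max |a| |b|, Eventually.of_forall fun ω => ?_⟩
    by_cases hh : (W ω).2 = true <;> simp [s, hh]
  have hZ' : Bd P Z' := bd_add hZ hsb
  have hz0 : ψ Z' = 0 := by
    refine h.cx (fun ω => X ω + (-a)) (fun ω => Y ω + (-b)) Z' (bd_add hX (bd_const _))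
      (bd_add hY (bd_const _)) hZ' 0 ?_ ?_ l hl ?_
    · rw [h.cash X hX]; simp [ha]
    · rw [h.cash Y hY]; simp [hb]
    · simpa [s] using hZ'l
  refine ⟨Z, hZ, hZl, ?_, ?_⟩
  · have := h.mono (fun ω => Z' ω + min a b) Z (bd_add hZ' (bd_const _)) hZ
      (Eventually.of_forall fun ω => ?_)
    · rw [h.cash Z' hZ', hz0] at this
      simpa using this
    · have := min_le_left a b
      have := min_le_right a b
      have := le_max_left a b
      have := le_max_right a b
      by_cases hh : (W ω).2 = true <;> simp only [s, hh, Z, Z', if_true, Bool.false_eq_true, if_false] <;> linarith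
  · have := h.mono Z (fun ω => Z' ω + max a b) hZ (bd_add hZ' (bd_const _))
      (Eventually.of_forall fun ω => ?_)
    · rw [h.cash Z' hZ', hz0] at this
      simpa using this
    · have := min_le_left a b
      have := min_le_right a b
      have := le_max_left a b
      have := le_max_right a b
      by_cases hh : (W ω).2 = true <;> simp only [s, hh, Z, Z', if_true, Bool.false_eq_true, if_false] <;> linarith

lemma mix_meas (μ ν : Measure ℝ) {c d : ℝ} (hc : 0 < c) (hd : 0 < d) :
    ENNReal.ofReal c • μ + ENNReal.ofReal d • ν = ENNReal.ofReal (c + d) •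
      (ENNReal.ofReal (c / (c + d)) • μ + ENNReal.ofReal (1 - c / (c + d)) • ν) := by
  have hcd : 0 < c + d := by positivity
  rw [smul_add, smul_smul, smul_smul, ← ENNReal.ofReal_mul hcd.le, ← ENNReal.ofReal_mul hcd.le]
  congr 3 <;> field_simp
  ring

lemma mix_mem {c d : ℝ} (hc : 0 < c) (hd : 0 < d) : c / (c + d) ∈ Set.Ioo (0 : ℝ) 1 :=
  ⟨by positivity, by rw [div_lt_one (by positivity)]; linarith⟩

lemma PsiData.neg_add (h : PsiData P ψ) {μ ν : Measure ℝ} (h1 : Neg P ψ μ) (h2 : Neg P ψ ν) :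
    Neg P ψ (μ + ν) := by
  obtain ⟨X, hX, c, hc, rfl, hψ⟩ := h1
  obtain ⟨Y, hY, d, hd, rfl, hψ'⟩ := h2
  obtain ⟨Z, hZ, hZl, -, hz⟩ := h.mix hX hY (mix_mem hc hd)
  exact ⟨Z, hZ, c + d, by positivity, by rw [mix_meas _ _ hc hd, hZl], hz.trans (max_le hψ hψ')⟩

lemma PsiData.pos_add (h : PsiData P ψ) {μ ν : Measure ℝ} (h1 : Pos P ψ μ) (h2 : Pos P ψ ν) :
    Pos P ψ (μ + ν) := by
  obtain ⟨X, hX, c, hc, rfl, hψ⟩ := h1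
  obtain ⟨Y, hY, d, hd, rfl, hψ'⟩ := h2
  obtain ⟨Z, hZ, hZl, hz, -⟩ := h.mix hX hY (mix_mem hc hd)
  exact ⟨Z, hZ, c + d, by positivity, by rw [mix_meas _ _ hc hd, hZl], (lt_min hψ hψ').trans_le hz⟩

lemma PsiData.neg_dirac (h : PsiData P ψ) {x : ℝ} (hx : x ≤ 0) : Neg P ψ (Measure.dirac x) := by
  refine ⟨fun _ => x, bd_const x, 1, one_pos, ?_, by rwa [h.const]⟩
  simp [Measure.map_const]

lemma PsiData.pos_dirac (h : PsiData P ψ) {x : ℝ} (hx : 0 < x) : Pos P ψ (Measure.dirac x) := by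
  refine ⟨fun _ => x, bd_const x, 1, one_pos, ?_, by rwa [h.const]⟩
  simp [Measure.map_const]

/-- averaging and monotonicity -/
lemma PsiData.avg (h : PsiData P ψ) {n : ℕ} [NeZero n] (a : Fin n → ℝ) (c d w : ℝ) (hw : 0 ≤ w)
    (hc : n * c ≤ ∑ i, a i)
    (hneg : Neg P ψ (∑ i, Measure.dirac (a i) + ENNReal.ofReal w • Measure.dirac d)) :
    Neg P ψ (ENNReal.ofReal n • Measure.dirac c + ENNReal.ofReal w • Measure.dirac d) := by
  have hn : (0 : ℝ) < n := by exact_mod_cast Nat.pos_of_ne_zero (NeZero.ne n)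
  set T : ℝ := n + w with hT
  have hTp : 0 < T := by positivity
  set M : Measure (Fin n × Bool) := ∑ i, Measure.dirac (i, true) +
    ENNReal.ofReal (w / n) • ∑ i, Measure.dirac (i, false) with hM
  have hMmap : ∀ f : Fin n × Bool → ℝ, M.map f = ∑ i, Measure.dirac (f (i, true)) +
      ENNReal.ofReal (w / n) • ∑ i, Measure.dirac (f (i, false)) := by
    intro f
    have hf : Measurable f := measurable_of_finite f
    rw [hM, Measure.map_add _ _ hf, Measure.map_smul, Measure.map_finset_sum hf.aemeasurable,
      Measure.map_finset_sum hf.aemeasurable]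
    simp only [Measure.map_dirac' hf]
  have hmass : ENNReal.ofReal (w / n) * n = ENNReal.ofReal w := by
    rw [← ENNReal.ofReal_natCast, ← ENNReal.ofReal_mul (by positivity)]
    congr 1; field_simp
  set Q := ENNReal.ofReal T⁻¹ • M with hQ
  have hQp : IsProbabilityMeasure Q := by
    refine ⟨?_⟩
    rw [hQ, hM]
    simp only [Measure.smul_apply, Measure.add_apply, Measure.finsetSum_apply, measure_univ,
      smul_eq_mul]
    simp only [Finset.sum_const, Finset.card_univ, Fintype.card_fin, nsmul_eq_mul, mul_one]
    rw [hmass, ← ENNReal.ofReal_natCast, ← ENNReal.ofReal_add hn.le hw,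
      ← ENNReal.ofReal_mul (by positivity), ← hT, inv_mul_cancel₀ hTp.ne']
    simp
  have : Nonempty (Fin n × Bool) := ⟨(0, true)⟩
  obtain ⟨W, hW, hWl⟩ := h.realize Q
  have hlaw : ∀ f : Fin n × Bool → ℝ, P.map (fun ω => f (W ω)) = ENNReal.ofReal T⁻¹ •
      (∑ i, Measure.dirac (f (i, true)) +
        ENNReal.ofReal (w / n) • ∑ i, Measure.dirac (f (i, false))) := by
    intro f
    have hf : Measurable f := measurable_of_finite f
    rw [← hMmap, ← Measure.map_smul, ← hQ, ← hWl, Measure.map_map hf hW]; rfl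
  have hbd : ∀ f : Fin n × Bool → ℝ, Bd P (fun ω => f (W ω)) := by
    intro f
    have hf : Measurable f := measurable_of_finite f
    refine ⟨hf.comp hW, ∑ p, |f p|, Eventually.of_forall fun ω => ?_⟩
    exact Finset.single_le_sum (f := fun p => |f p|) (fun _ _ => abs_nonneg _) (Finset.mem_univ (W ω))
  let f : Fin n → Fin n × Bool → ℝ := fun k p => if p.2 then a (p.1 + k) else d
  have hfl : ∀ k, P.map (fun ω => f k (W ω)) = ENNReal.ofReal T⁻¹ •
      (∑ i, Measure.dirac (a i) + ENNReal.ofReal w • Measure.dirac d) := by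
    intro k
    rw [hlaw]
    simp only [f, if_true, Bool.false_eq_true, if_false, Finset.sum_const, Finset.card_univ,
      Fintype.card_fin]
    have e := Equiv.sum_comp (Equiv.addRight k) (fun i => Measure.dirac (a i))
    simp only [Equiv.coe_addRight] at e
    rw [← hmass, mul_smul, Nat.cast_smul_eq_nsmul, e]
  have hψf : ∀ k, ψ (fun ω => f k (W ω)) ≤ 0 := by
    intro k
    obtain ⟨X, hX, e, he, hXl, hψ⟩ := hneg
    have h2 := hfl k
    rw [hXl, smul_smul, ← ENNReal.ofReal_mul (by positivity)] at h2
    have h3 := smul_law_eq (P := P) (c := 1) (hbd (f k)).1 hX.1 one_pos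
      (d := T⁻¹ * e) (by positivity) (by rw [← h2]; simp)
    rw [h.law _ _ (hbd (f k)) hX h3.2]
    exact hψ
  let g : Fin n × Bool → ℝ := fun p => if p.2 then c else d
  have hJ := h.convexOn.map_sum_le (t := Finset.univ) (w := fun _ : Fin n => (n : ℝ)⁻¹)
    (p := fun k => fun ω => f k (W ω)) (fun _ _ => by positivity) (by simp [hn.ne'])
    (fun k _ => hbd (f k))
  have hJ2 : ∑ k : Fin n, (n : ℝ)⁻¹ • ψ (fun ω => f k (W ω)) ≤ 0 :=
    Finset.sum_nonpos fun k _ => mul_nonpos_of_nonneg_of_nonpos (by positivity) (hψf k)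
  have hbdavg : Bd P (∑ k : Fin n, (n : ℝ)⁻¹ • fun ω => f k (W ω)) :=
    h.convexOn.1.sum_mem (fun _ _ => by positivity) (by simp [hn.ne']) (fun k _ => hbd (f k))
  have hg : ψ (fun ω => g (W ω)) ≤ 0 := by
    refine (h.mono _ _ (hbd g) hbdavg (Eventually.of_forall fun ω => ?_)).trans (hJ.trans hJ2)
    simp only [Finset.sum_apply, Pi.smul_apply, smul_eq_mul, ← Finset.mul_sum]
    by_cases hh : (W ω).2 = true
    · simp only [g, f, hh, if_true]
      have e := Equiv.sum_comp (Equiv.addLeft (W ω).1) a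
      simp only [Equiv.coe_addLeft] at e
      rw [e, inv_mul_eq_div, le_div_iff₀ hn]
      linarith
    · simp [g, f, hh, hn.ne']
  refine ⟨_, hbd g, T, hTp, ?_, hg⟩
  rw [hlaw, smul_smul, ← ENNReal.ofReal_mul hTp.le, mul_inv_cancel₀ hTp.ne', ENNReal.ofReal_one,
    one_smul]
  simp only [g, if_true, Bool.false_eq_true, if_false, Finset.sum_const, Finset.card_univ,
      Fintype.card_fin]
  rw [← hmass, mul_smul, Nat.cast_smul_eq_nsmul, ENNReal.ofReal_natCast, Nat.cast_smul_eq_nsmul]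

end basic

section riesz

lemma exists_functional {T : Type*} (y0 : T) (C C' : Set (T →₀ ℝ)) (hC0 : 0 ∈ C) (hC0' : 0 ∈ C')
    (hCa : ∀ u ∈ C, ∀ v ∈ C, u + v ∈ C) (hCa' : ∀ u ∈ C', ∀ v ∈ C', u + v ∈ C')
    (hCs : ∀ u ∈ C, ∀ c : ℝ, 0 < c → c • u ∈ C) (hCs' : ∀ u ∈ C', ∀ c : ℝ, 0 < c → c • u ∈ C')
    (hd : ∀ u ∈ C, ∀ v ∈ C', ∀ t : ℝ, 0 < t → v + Finsupp.single y0 t = u → False)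
    (h1 : ∀ z, ∃ t : ℝ, ∃ u ∈ C, ∃ v ∈ C', Finsupp.single y0 t + Finsupp.single z 1 = v - u)
    (h2 : ∀ z, ∃ t : ℝ, ∃ u ∈ C, ∃ v ∈ C', Finsupp.single y0 t - Finsupp.single z 1 = v - u) :
    ∃ g : (T →₀ ℝ) →ₗ[ℝ] ℝ, g (Finsupp.single y0 1) = 1 ∧ (∀ v ∈ C', 0 ≤ g v) ∧
      ∀ u ∈ C, g u ≤ 0 := by
  let s : PointedCone ℝ (T →₀ ℝ) :=
    { carrier := {x | ∃ u ∈ C, ∃ v ∈ C', x = v - u}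
      add_mem' := by
        rintro _ _ ⟨u, hu, v, hv, rfl⟩ ⟨u', hu', v', hv', rfl⟩
        exact ⟨u + u', hCa _ hu _ hu', v + v', hCa' _ hv _ hv', by abel⟩
      zero_mem' := ⟨0, hC0, 0, hC0', by simp⟩
      smul_mem' := by
        rintro ⟨c, hc⟩ _ ⟨u, hu, v, hv, rfl⟩
        rcases hc.eq_or_lt with rfl | hc'
        · refine ⟨0, hC0, 0, hC0', ?_⟩
          ext z; simp
        · refine ⟨c • u, hCs _ hu _ hc', c • v, hCs' _ hv _ hc', ?_⟩
          ext z; simp [mul_sub] }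
  have hs : ∀ x, x ∈ s ↔ ∃ u ∈ C, ∃ v ∈ C', x = v - u := fun x => Iff.rfl
  have hsm : ∀ x ∈ s, ∀ c : ℝ, 0 ≤ c → c • x ∈ s := fun x hx c hc => by
    have := Submodule.smul_mem s (⟨c, hc⟩ : {c : ℝ // 0 ≤ c}) hx
    exact this
  have hne : (Finsupp.single y0 1 : T →₀ ℝ) ≠ 0 := by simp
  let f : (T →₀ ℝ) →ₗ.[ℝ] ℝ := LinearPMap.mkSpanSingleton (Finsupp.single y0 1) (1 : ℝ) hne
  have hdom : ∀ t : ℝ, Finsupp.single y0 t ∈ f.domain := by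
    intro t
    refine Submodule.mem_span_singleton.2 ⟨t, by simp⟩
  have hf : ∀ t : ℝ, f ⟨Finsupp.single y0 t, hdom t⟩ = t := by
    intro t
    have e : (⟨Finsupp.single y0 t, hdom t⟩ : f.domain) = t • ⟨Finsupp.single y0 1, hdom 1⟩ := by
      ext; simp
    rw [e, LinearPMap.map_smul]
    have := LinearPMap.mkSpanSingleton_apply ℝ ℝ (σ := RingHom.id ℝ) hne (1 : ℝ)
    change t • f _ = t
    erw [this]
    simp
  have hA : ∀ x : f.domain, (x : T →₀ ℝ) ∈ s → 0 ≤ f x := by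
    rintro ⟨x, hx⟩ hxs
    obtain ⟨t, rfl⟩ := Submodule.mem_span_singleton.1 hx
    have e : (⟨t • Finsupp.single y0 1, hx⟩ : f.domain) = ⟨Finsupp.single y0 t, hdom t⟩ := by
      ext; simp
    rw [e, hf]
    by_contra hlt
    push Not at hlt
    obtain ⟨u, hu, v, hv, huv⟩ := hxs
    refine hd u hu v hv (-t) (by linarith) ?_
    have huv' : Finsupp.single y0 t = v - u := by simpa using huv
    rw [Finsupp.single_neg, huv']
    abel
  have hB : ∀ y, ∃ x : f.domain, (x : T →₀ ℝ) + y ∈ s := by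
    have key : ∀ y : T →₀ ℝ, ∃ t : ℝ, Finsupp.single y0 t + y ∈ s := by
      intro y
      induction y using Finsupp.induction_linear with
      | zero => exact ⟨0, by simp⟩
      | add a b ha hb =>
        obtain ⟨t, ht⟩ := ha
        obtain ⟨t', ht'⟩ := hb
        refine ⟨t + t', ?_⟩
        have := s.add_mem ht ht'
        rw [Finsupp.single_add]
        convert this using 1
        abel
      | single z a =>
        rcases le_total 0 a with ha | ha
        · obtain ⟨t, ht⟩ := h1 z
          refine ⟨a * t, ?_⟩
          have := hsm _ ((hs _).2 ht) a ha
          simpa using this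
        · obtain ⟨t, ht⟩ := h2 z
          refine ⟨(-a) * t, ?_⟩
          have := hsm _ ((hs _).2 ht) (-a) (by linarith)
          rw [smul_sub] at this
          simpa [sub_eq_add_neg] using this
    intro y
    obtain ⟨t, ht⟩ := key y
    exact ⟨⟨_, hdom t⟩, ht⟩
  obtain ⟨g, hg, hgs⟩ := riesz_extension s f hA hB
  refine ⟨g, ?_, ?_, ?_⟩
  · have := hg ⟨Finsupp.single y0 1, hdom 1⟩
    rw [hf] at this
    exact this
  · intro v hv
    exact hgs v ⟨0, hC0, v, hv, by simp⟩
  · intro u hu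
    have := hgs (-u) ⟨u, hu, 0, hC0', by simp⟩
    rw [map_neg] at this
    linarith

/-- The measure attached to a finitely supported weight. -/
def meas {D : Set ℝ} (w : D →₀ ℝ) : Measure ℝ :=
  w.sum fun z a => ENNReal.ofReal a • Measure.dirac (z : ℝ)

variable {D : Set ℝ}

lemma meas_single (z : D) (a : ℝ) :
    meas (Finsupp.single z a) = ENNReal.ofReal a • Measure.dirac (z : ℝ) := by
  simp [meas, Finsupp.sum_single_index]

lemma meas_zero : meas (0 : D →₀ ℝ) = 0 := by simp [meas]

lemma meas_add {u v : D →₀ ℝ} (hu : 0 ≤ u) (hv : 0 ≤ v) : meas (u + v) = meas u + meas v := by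
  classical
  unfold meas
  rw [Finsupp.sum_of_support_subset (s := u.support ∪ v.support) _ Finsupp.support_add _ (by simp),
    Finsupp.sum_of_support_subset u Finset.subset_union_left _ (by simp),
    Finsupp.sum_of_support_subset v Finset.subset_union_right _ (by simp),
    ← Finset.sum_add_distrib]
  refine Finset.sum_congr rfl fun z _ => ?_
  rw [Finsupp.add_apply, ENNReal.ofReal_add (hu z) (hv z), add_smul]

lemma meas_smul {u : D →₀ ℝ} {c : ℝ} (hc : 0 ≤ c) : meas (c • u) = ENNReal.ofReal c • meas u := by
  unfold meas
  rw [Finsupp.sum_smul_index (by simp), Finsupp.smul_sum]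
  simp only [ENNReal.ofReal_mul hc, mul_smul]

lemma meas_sum {ι : Type*} (s : Finset ι) (z : ι → D) (a : ι → ℝ) (ha : ∀ i, 0 ≤ a i) :
    0 ≤ ∑ i ∈ s, Finsupp.single (z i) (a i) ∧
    meas (∑ i ∈ s, Finsupp.single (z i) (a i)) =
      ∑ i ∈ s, ENNReal.ofReal (a i) • Measure.dirac (z i : ℝ) := by
  classical
  have hn : ∀ i, 0 ≤ Finsupp.single (z i) (a i) := fun i => Finsupp.single_nonneg.2 (ha i)
  refine ⟨Finset.sum_nonneg fun i _ => hn i, ?_⟩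
  induction s using Finset.induction_on with
  | empty => simp [meas_zero]
  | insert i s hi ih =>
    rw [Finset.sum_insert hi, Finset.sum_insert hi,
      meas_add (hn i) (Finset.sum_nonneg fun i _ => hn i), ih, meas_single]

end riesz

section construct

variable {P : Measure Ω} [IsProbabilityMeasure P] {ψ : (Ω → ℝ) → ℝ}

/-- The effective domain of the loss function. -/
def dom (P : Measure Ω) (ψ : (Ω → ℝ) → ℝ) : Set ℝ :=
  {y | y ≤ 0 ∨ ∃ x < 0, ∃ q : ℝ, 0 < q ∧
    Neg P ψ (Measure.dirac y + ENNReal.ofReal q • Measure.dirac x)}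

lemma PsiData.dom_down (h : PsiData P ψ) {a b : ℝ} (ha : a ∈ dom P ψ) (hb : b ≤ a) :
    b ∈ dom P ψ := by
  rcases ha with ha | ⟨x, hx, q, hq, hn⟩
  · exact Or.inl (hb.trans ha)
  · refine Or.inr ⟨x, hx, q, hq, ?_⟩
    have := h.avg (n := 1) (fun _ => a) b x q hq.le (by simpa using hb) (by simpa using hn)
    simpa using this

lemma PsiData.ae_dom (h : PsiData P ψ) {Y : Ω → ℝ} (hY : Bd P Y) (hf : (range Y).Finite)
    (hψ : ψ Y ≤ 0) : ∀ᵐ ω ∂P, Y ω ∈ dom P ψ := by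
  have key : ∀ z ∈ range Y, z ∉ dom P ψ → ∀ᵐ ω ∂P, Y ω ≠ z := by
    intro z _ hz
    by_contra hne
    have hA : MeasurableSet {ω | Y ω = z} := hY.1 (measurableSet_singleton z)
    have hp0 : P {ω | Y ω = z} ≠ 0 := by
      intro h0
      apply hne
      rw [ae_iff]
      simpa using h0
    have hp : 0 < P.real {ω | Y ω = z} := ENNReal.toReal_pos hp0 (measure_ne_top _ _)
    set p := P.real {ω | Y ω = z} with hpdef
    have hp1 : p ≤ 1 := measureReal_le_one
    obtain ⟨hm, K, hK⟩ := hY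
    set x : ℝ := -(|K| + 1) with hx
    have hxneg : x < 0 := by have := abs_nonneg K; linarith
    let Y' : Ω → ℝ := fun ω => if Y ω = z then z else x
    have hY'm : Measurable Y' := Measurable.ite hA measurable_const measurable_const
    have hY' : Bd P Y' := by
      refine ⟨hY'm, max |z| |x|, Eventually.of_forall fun ω => ?_⟩
      by_cases hh : Y ω = z <;> simp [Y', hh]
    have hle : ψ Y' ≤ 0 := by
      refine (h.mono Y' Y hY' ⟨hm, K, hK⟩ ?_).trans hψ
      filter_upwards [hK] with ω hω
      by_cases hh : Y ω = z
      · simp [Y', hh]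
      · simp only [Y', hh, if_false]
        have := neg_abs_le (Y ω)
        have := le_abs_self K
        linarith
    have hlaw : P.map Y' = ENNReal.ofReal p • Measure.dirac z +
        ENNReal.ofReal (1 - p) • Measure.dirac x := by
      conv_lhs => rw [← Measure.restrict_add_restrict_compl (μ := P) hA]
      rw [Measure.map_add _ _ hY'm]
      have e1 : (P.restrict {ω | Y ω = z}).map Y' = ENNReal.ofReal p • Measure.dirac z := by
        rw [Measure.map_congr (g := fun _ => z), Measure.map_const]
        · simp [hpdef, ofReal_measureReal]
        · filter_upwards [ae_restrict_mem hA] with ω hω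
          have : Y ω = z := hω
          simp [Y', this]
      have e2 : (P.restrict {ω | Y ω = z}ᶜ).map Y' = ENNReal.ofReal (1 - p) • Measure.dirac x := by
        rw [Measure.map_congr (g := fun _ => x), Measure.map_const]
        · rw [hpdef, ← probReal_compl_eq_one_sub hA]
          simp [ofReal_measureReal]
        · filter_upwards [ae_restrict_mem hA.compl] with ω hω
          have : ¬ Y ω = z := hω
          simp [Y', this]
      rw [e1, e2]
    have hn : Neg P ψ (ENNReal.ofReal p • Measure.dirac z +
        ENNReal.ofReal (1 - p) • Measure.dirac x) :=
      ⟨Y', hY', 1, one_pos, by simp [hlaw], hle⟩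
    have hn2 := (h.neg_add hn (h.neg_dirac hxneg.le)).smul (c := p⁻¹) (by positivity)
    apply hz
    refine Or.inr ⟨x, hxneg, p⁻¹ * (1 - p + 1), by
      have : 0 < 1 - p + 1 := by linarith
      positivity, ?_⟩
    convert hn2 using 1
    rw [smul_add, smul_add, smul_smul, smul_smul, ← ENNReal.ofReal_mul (by positivity),
      ← ENNReal.ofReal_mul (by positivity), inv_mul_cancel₀ hp.ne', ENNReal.ofReal_one, one_smul,
      add_assoc, ← add_smul, ← ENNReal.ofReal_add (mul_nonneg (by positivity) (by linarith))
        (by positivity)]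
    congr 3
    ring
  have : ∀ᵐ ω ∂P, ∀ z ∈ range Y, z ∉ dom P ψ → Y ω ≠ z := by
    rw [ae_ball_iff hf.countable]
    intro z hz
    by_cases hzd : z ∈ dom P ψ
    · exact Eventually.of_forall fun _ hh => absurd hzd hh
    · filter_upwards [key z hz hzd] with ω hω _ using hω
  filter_upwards [this] with ω hω
  by_contra hc
  exact hω (Y ω) ⟨ω, rfl⟩ hc rfl

lemma PsiData.large (h : PsiData P ψ) {y : ℝ} (hy : 0 < y) (z : ℝ) :
    ∃ t : ℝ, 0 < t ∧ Pos P ψ (ENNReal.ofReal t • Measure.dirac y + Measure.dirac z) := by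
  obtain ⟨n, hn⟩ := exists_nat_gt (|z| / y)
  have hnp : (0 : ℝ) < n := lt_of_le_of_lt (by positivity) hn
  rw [div_lt_iff₀ hy] at hn
  refine ⟨n, hnp, ?_⟩
  have hfin : IsFiniteMeasure (ENNReal.ofReal n • Measure.dirac y + Measure.dirac z) := by
    have := Measure.smul_finite (Measure.dirac y) (c := ENNReal.ofReal n) ENNReal.ofReal_ne_top
    infer_instance
  have hA : ENNReal.ofReal n • Measure.dirac y + Measure.dirac z ≠ 0 := by
    intro h0
    have := congrArg (fun m : Measure ℝ => m Set.univ) h0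
    simp at this
  have hB : ∀ᵐ t ∂(ENNReal.ofReal n • Measure.dirac y + Measure.dirac z), |t| ≤ max |y| |z| := by
    rw [ae_add_measure_iff]
    constructor
    · refine Measure.ae_smul_measure ?_ _
      rw [ae_dirac_eq]
      simp
    · rw [ae_dirac_eq]
      simp
  rcases h.neg_or_pos hA hB with h1 | h1
  · exfalso
    have h2 := h.avg (n := n + 1) (Fin.snoc (fun _ => y) z) ((n * y + z) / (n + 1)) 0 0 le_rfl
      (by
        rw [Fin.sum_univ_castSucc]
        simp
        field_simp
        rfl)
      (by
        rw [Fin.sum_univ_castSucc]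
        simpa [Nat.cast_smul_eq_nsmul] using h1)
    have hpos : 0 < (n * y + z) / (n + 1) := by
      have := neg_abs_le z
      apply div_pos <;> linarith
    have h3 := (h.pos_dirac hpos).smul (c := ((n + 1 : ℕ) : ℝ)) (by positivity)
    refine h.not_neg_pos h2 ?_
    simpa using h3
  · exact h1

end construct

section ell

variable {P : Measure Ω} [IsProbabilityMeasure P] {ψ : (Ω → ℝ) → ℝ}

lemma not_pos_zero : ¬ Pos P ψ (0 : Measure ℝ) := by
  rintro ⟨X, hX, c, hc, h0, -⟩
  have := congrArg (fun m : Measure ℝ => m Set.univ) h0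
  simp [Measure.map_apply hX.1 MeasurableSet.univ] at this
  linarith

lemma PsiData.exists_g (h : PsiData P ψ) {y0 : ℝ} (hy0 : 0 < y0) (hyd : y0 ∈ dom P ψ) :
    ∃ g : (dom P ψ →₀ ℝ) →ₗ[ℝ] ℝ, g (Finsupp.single ⟨y0, hyd⟩ 1) = 1 ∧
      (∀ w, 0 ≤ w → Pos P ψ (meas w) → 0 ≤ g w) ∧
      (∀ w, 0 ≤ w → Neg P ψ (meas w) → g w ≤ 0) := by
  have hs : ∀ (z : dom P ψ) (a : ℝ), 0 ≤ a → (0 : dom P ψ →₀ ℝ) ≤ Finsupp.single z a :=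
    fun z a ha => Finsupp.single_nonneg.2 ha
  obtain ⟨g, hg1, hg2, hg3⟩ := exists_functional (⟨y0, hyd⟩ : dom P ψ)
    {w | w = 0 ∨ (0 ≤ w ∧ Neg P ψ (meas w))} {w | w = 0 ∨ (0 ≤ w ∧ Pos P ψ (meas w))}
    (Or.inl rfl) (Or.inl rfl)
    (by
      rintro u (rfl | ⟨hu, hu'⟩) v (rfl | ⟨hv, hv'⟩)
      · left; simp
      · right; simpa using ⟨hv, hv'⟩
      · right; simpa using ⟨hu, hu'⟩
      · right; exact ⟨add_nonneg hu hv, by rw [meas_add hu hv]; exact h.neg_add hu' hv'⟩)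
    (by
      rintro u (rfl | ⟨hu, hu'⟩) v (rfl | ⟨hv, hv'⟩)
      · left; simp
      · right; simpa using ⟨hv, hv'⟩
      · right; simpa using ⟨hu, hu'⟩
      · right; exact ⟨add_nonneg hu hv, by rw [meas_add hu hv]; exact h.pos_add hu' hv'⟩)
    (by
      rintro u (rfl | ⟨hu, hu'⟩) c hc
      · left; simp
      · right; exact ⟨smul_nonneg hc.le hu, by rw [meas_smul hc.le]; exact hu'.smul hc⟩)
    (by
      rintro u (rfl | ⟨hu, hu'⟩) c hc
      · left; simp
      · right; exact ⟨smul_nonneg hc.le hu, by rw [meas_smul hc.le]; exact hu'.smul hc⟩)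
    (by
      intro u hu v hv t ht e
      have hp : Pos P ψ (meas u) := by
        rw [← e]
        have hpt : Pos P ψ (meas (Finsupp.single (⟨y0, hyd⟩ : dom P ψ) t)) := by
          rw [meas_single]; exact (h.pos_dirac hy0).smul ht
        rcases hv with rfl | ⟨hv, hv'⟩
        · simpa using hpt
        · rw [meas_add hv (hs _ _ ht.le)]
          exact h.pos_add hv' hpt
      rcases hu with rfl | ⟨hu, hu'⟩
      · rw [meas_zero] at hp
        exact not_pos_zero hp
      · exact h.not_neg_pos hu' hp)
    (by
      intro z
      obtain ⟨t, ht, hp⟩ := h.large hy0 z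
      refine ⟨t, 0, Or.inl rfl, _, Or.inr ⟨add_nonneg (hs ⟨y0, hyd⟩ t ht.le) (hs z 1 zero_le_one), ?_⟩,
        by simp⟩
      rw [meas_add (hs _ t ht.le) (hs z 1 zero_le_one), meas_single, meas_single]
      simpa using hp)
    (by
      rintro ⟨z, hz⟩
      by_cases hz0 : z ≤ 0
      · refine ⟨0, Finsupp.single ⟨z, hz⟩ 1, Or.inr ⟨hs _ 1 zero_le_one, ?_⟩, 0, Or.inl rfl, by simp⟩
        rw [meas_single]
        simpa using h.neg_dirac hz0
      · rcases id hz with hz1 | ⟨x, hx, q, hq, hn⟩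
        · exact absurd hz1 hz0
        obtain ⟨t, ht, hp⟩ := h.large hy0 x
        have hxd : x ∈ dom P ψ := Or.inl hx.le
        refine ⟨q * t, Finsupp.single ⟨z, hz⟩ 1 + Finsupp.single ⟨x, hxd⟩ q,
          Or.inr ⟨add_nonneg (hs _ 1 zero_le_one) (hs _ q hq.le), ?_⟩,
          Finsupp.single ⟨y0, hyd⟩ (q * t) + Finsupp.single ⟨x, hxd⟩ q,
          Or.inr ⟨add_nonneg (hs _ _ (by positivity)) (hs _ q hq.le), ?_⟩, by abel⟩
        · rw [meas_add (hs _ 1 zero_le_one) (hs _ q hq.le), meas_single, meas_single]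
          simpa using hn
        · rw [meas_add (hs _ _ (by positivity)) (hs _ q hq.le), meas_single, meas_single]
          have := hp.smul hq
          rw [smul_add, smul_smul, ← ENNReal.ofReal_mul hq.le] at this
          exact this)
  exact ⟨g, hg1, fun w hw hp => hg2 w (Or.inr ⟨hw, hp⟩), fun w hw hp => hg3 w (Or.inr ⟨hw, hp⟩)⟩

lemma PsiData.meas_neg_or_pos (h : PsiData P ψ) {D : Set ℝ} (w : D →₀ ℝ) (hw : 0 ≤ w) (hne : w ≠ 0) :
    Neg P ψ (meas w) ∨ Pos P ψ (meas w) := by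
  have hfin : IsFiniteMeasure (meas w) := by
    refine ⟨?_⟩
    unfold meas Finsupp.sum
    rw [Measure.finsetSum_apply]
    refine ENNReal.sum_lt_top.2 fun z _ => ?_
    simp
  have hm : meas w ≠ 0 := by
    obtain ⟨z, hz⟩ := Finsupp.ne_iff.1 hne
    intro h0
    have := congrArg (fun m : Measure ℝ => m Set.univ) h0
    unfold meas Finsupp.sum at this
    simp only [Measure.finsetSum_apply] at this
    have h2 := (Finset.sum_eq_zero_iff.1 this) z (by simpa using hz)
    simp at h2
    have := hw z
    simp at hz this
    exact hz (le_antisymm h2 this)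
  have hK : ∀ᵐ t ∂(meas w), |t| ≤ ∑ z ∈ w.support, |(z : ℝ)| := by
    rw [ae_iff]
    unfold meas Finsupp.sum
    rw [Measure.finsetSum_apply]
    refine Finset.sum_eq_zero fun z hz => ?_
    have hms : MeasurableSet {a : ℝ | ¬ |a| ≤ ∑ z ∈ w.support, |(z : ℝ)|} :=
      (measurableSet_le (continuous_abs.measurable) measurable_const).compl
    rw [Measure.smul_apply, Measure.dirac_apply' _ hms, indicator_of_notMem]
    · simp
    · simp only [mem_setOf_eq, not_not]
      exact Finset.single_le_sum (f := fun z : D => |(z : ℝ)|) (fun _ _ => abs_nonneg _) hz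
  exact h.neg_or_pos hm hK

lemma law_meas {D : Set ℝ} {Y : Ω → ℝ} (hY : Measurable Y) (hf : (range Y).Finite)
    (hD : ∀ ω, Y ω ∈ D) :
    ∃ w : D →₀ ℝ, 0 ≤ w ∧ P.map Y = meas w ∧
      ∀ g : (D →₀ ℝ) →ₗ[ℝ] ℝ, ∫ ω, g (Finsupp.single ⟨Y ω, hD ω⟩ 1) ∂P = g w := by
  classical
  have := hf.fintype
  have hzD : ∀ z : range Y, z.1 ∈ D := by rintro ⟨_, ω, rfl⟩; exact hD ω
  obtain ⟨h0, hm⟩ := meas_sum (D := D) (Finset.univ : Finset (range Y)) (fun z => ⟨z.1, hzD z⟩)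
    (fun z => P.real (Y ⁻¹' {z.1})) (fun _ => measureReal_nonneg)
  refine ⟨_, h0, ?_, ?_⟩
  · rw [hm]
    ext s hs
    rw [Measure.map_apply hY hs, Measure.finsetSum_apply]
    have e : Y ⁻¹' s = ⋃ z ∈ (Finset.univ : Finset (range Y)), (Y ⁻¹' {z.1} ∩ {_ω | z.1 ∈ s}) := by
      ext ω
      simp only [Finset.mem_univ, iUnion_true, mem_iUnion, mem_inter_iff, mem_preimage,
        mem_singleton_iff, mem_setOf_eq]
      constructor
      · intro hω
        exact ⟨⟨Y ω, ω, rfl⟩, rfl, hω⟩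
      · rintro ⟨z, h1, h2⟩
        rw [h1]; exact h2
    rw [e, measure_biUnion_finset]
    · refine Finset.sum_congr rfl fun z _ => ?_
      by_cases hz : z.1 ∈ s <;> simp [hz, Measure.dirac_apply' _ hs, ofReal_measureReal]
    · intro a _ b _ hab
      refine Set.disjoint_left.2 fun ω h1 h2 => hab ?_
      ext
      exact h1.1.symm.trans h2.1
    · intro z _
      exact (hY (measurableSet_singleton _)).inter (MeasurableSet.const _)
  · intro g
    have e : ∀ ω, g (Finsupp.single ⟨Y ω, hD ω⟩ 1) =
        ∑ z : range Y, (Y ⁻¹' {z.1}).indicator (fun _ => g (Finsupp.single ⟨z.1, hzD z⟩ 1)) ω := by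
      intro ω
      rw [Finset.sum_eq_single (⟨Y ω, ω, rfl⟩ : range Y)]
      · simp
      · intro b _ hb
        refine indicator_of_notMem (fun hc => hb ?_) _
        ext; exact (show Y ω = b.1 from hc).symm
      · simp
    simp_rw [e]
    rw [integral_finsetSum, map_sum]
    · refine Finset.sum_congr rfl fun z _ => ?_
      rw [integral_indicator_const _ (hY (measurableSet_singleton _)), ← map_smul]
      simp
    · intro z _
      exact (integrable_const _).indicator (hY (measurableSet_singleton _))

lemma PsiData.trick (h : PsiData P ψ) (g : (dom P ψ →₀ ℝ) →ₗ[ℝ] ℝ) {x0 y0 : dom P ψ}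
    (hx0 : g (Finsupp.single x0 1) < 0) (hy0 : g (Finsupp.single y0 1) = 1)
    (hgp : ∀ w, 0 ≤ w → Pos P ψ (meas w) → 0 ≤ g w)
    (hgn : ∀ w, 0 ≤ w → Neg P ψ (meas w) → g w ≤ 0) {n : ℕ} [NeZero n] (a : Fin n → dom P ψ)
    (c : dom P ψ) (hc : n * (c : ℝ) ≤ ∑ i, (a i : ℝ)) :
    n * g (Finsupp.single c 1) ≤ ∑ i, g (Finsupp.single (a i) 1) := by
  have hgs : ∀ (z : dom P ψ) (t : ℝ), g (Finsupp.single z t) = t * g (Finsupp.single z 1) := by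
    intro z t
    rw [← smul_eq_mul, ← map_smul]; simp
  by_contra hlt
  push Not at hlt
  set S := ∑ i, g (Finsupp.single (a i) 1) with hS
  set mid := (n * g (Finsupp.single c 1) + S) / 2 with hmid
  have hdw : ∃ d : dom P ψ, ∃ w : ℝ, 0 ≤ w ∧ w * g (Finsupp.single d 1) = -mid := by
    rcases le_total 0 mid with hm | hm
    · refine ⟨x0, mid / (-g (Finsupp.single x0 1)), div_nonneg hm (by linarith), ?_⟩
      have : g (Finsupp.single x0 1) ≠ 0 := hx0.ne
      field_simp
    · exact ⟨y0, -mid, by linarith, by rw [hy0, mul_one]⟩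
  obtain ⟨d, w, hw, hwd⟩ := hdw
  have hnp : 0 < n := Nat.pos_of_ne_zero (NeZero.ne n)
  obtain ⟨hA0, hAm⟩ := meas_sum (Finset.univ : Finset (Fin n)) a (fun _ => 1) (fun _ => zero_le_one)
  have hsd : (0 : dom P ψ →₀ ℝ) ≤ Finsupp.single d w := Finsupp.single_nonneg.2 hw
  set A : dom P ψ →₀ ℝ := ∑ i : Fin n, Finsupp.single (a i) 1 with hAdef
  have hne : A + Finsupp.single d w ≠ 0 := by
    intro h0
    have hA' : A = 0 := le_antisymm (by rw [← h0]; exact le_add_of_nonneg_right hsd) hA0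
    have h1 : (0 : dom P ψ →₀ ℝ) (a ⟨0, hnp⟩) = 0 := rfl
    rw [← hA', hAdef, Finsupp.finsetSum_apply] at h1
    have h2 := (Finset.sum_eq_zero_iff_of_nonneg
      (fun i _ => (Finsupp.single_nonneg.2 zero_le_one : (0 : dom P ψ →₀ ℝ) ≤ Finsupp.single (a i) 1) _)).1 h1
      ⟨0, hnp⟩ (Finset.mem_univ _)
    simp at h2
  have hgA : g (A + Finsupp.single d w) = S - mid := by
    rw [map_add, hgs d w, hwd, hAdef, map_sum]; ring
  have hmeasA : meas (A + Finsupp.single d w) =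
      ∑ i, Measure.dirac (a i : ℝ) + ENNReal.ofReal w • Measure.dirac (d : ℝ) := by
    rw [meas_add hA0 hsd, hAm, meas_single]; simp
  rcases h.meas_neg_or_pos (A + Finsupp.single d w) (add_nonneg hA0 hsd) hne with hN | hPp
  · rw [hmeasA] at hN
    have h2 := h.avg (fun i => (a i : ℝ)) c d w hw hc hN
    have hsc : (0 : dom P ψ →₀ ℝ) ≤ Finsupp.single c (n : ℝ) := Finsupp.single_nonneg.2 (by positivity)
    have h3 := hgn (Finsupp.single c (n : ℝ) + Finsupp.single d w) (add_nonneg hsc hsd)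
      (by rw [meas_add hsc hsd, meas_single, meas_single]; exact h2)
    rw [map_add, hgs d w, hwd, hgs c n] at h3
    linarith
  · have := hgp _ (add_nonneg hA0 hsd) hPp
    rw [hgA] at this
    linarith

/-- Properties of the loss function `ℓ` on the domain `D`. -/
structure EllData (P : Measure Ω) (ψ : (Ω → ℝ) → ℝ) (D : Set ℝ) (ℓ : ℝ → ℝ) (x0 : ℝ) : Prop where
  zero_mem : Iic 0 ⊆ D
  down : ∀ a ∈ D, ∀ b ≤ a, b ∈ D
  mono : ∀ a ∈ D, ∀ b ≤ a, ℓ b ≤ ℓ a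
  conv : ∀ a ∈ D, ∀ b ∈ D, ∀ l ∈ Set.Ioo (0 : ℝ) 1, ℓ (l * a + (1 - l) * b) ≤ l * ℓ a + (1 - l) * ℓ b
  nonpos : ∀ x ≤ 0, ℓ x ≤ 0
  x0_le : x0 ≤ 0
  x0_neg : ℓ x0 < 0
  ae_dom : ∀ Y : Ω → ℝ, Bd P Y → (range Y).Finite → ψ Y ≤ 0 → ∀ᵐ ω ∂P, Y ω ∈ D
  int_neg : ∀ Y : Ω → ℝ, Bd P Y → (range Y).Finite → (∀ᵐ ω ∂P, Y ω ∈ D) → ψ Y ≤ 0 →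
    ∫ ω, ℓ (Y ω) ∂P ≤ 0
  int_pos : ∀ Y : Ω → ℝ, Bd P Y → (range Y).Finite → (∀ᵐ ω ∂P, Y ω ∈ D) → 0 < ψ Y →
    0 ≤ ∫ ω, ℓ (Y ω) ∂P

lemma PsiData.ae_eq (h : PsiData P ψ) {X Y : Ω → ℝ} (hX : Bd P X) (hY : Bd P Y)
    (hXY : ∀ᵐ ω ∂P, X ω = Y ω) : ψ X = ψ Y :=
  le_antisymm (h.mono X Y hX hY (hXY.mono fun _ h => h.le))
    (h.mono Y X hY hX (hXY.mono fun _ h => h.ge))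

lemma PsiData.exists_ell (h : PsiData P ψ) : ∃ D ℓ x0, EllData P ψ D ℓ x0 := by
  classical
  by_cases hcase : ∃ y ∈ dom P ψ, 0 < y
  · obtain ⟨y0, hyd, hy0⟩ := hcase
    obtain ⟨g, hg1, hgp, hgn⟩ := h.exists_g hy0 hyd
    rcases id hyd with hh | ⟨x0, hx0, q, hq, hn⟩
    · exact absurd hy0 (not_lt.2 hh)
    have hxd : x0 ∈ dom P ψ := Or.inl hx0.le
    have hgs : ∀ (z : dom P ψ) (t : ℝ), g (Finsupp.single z t) = t * g (Finsupp.single z 1) := by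
      intro z t
      rw [← smul_eq_mul, ← map_smul]; simp
    have hs : ∀ (z : dom P ψ) (a : ℝ), 0 ≤ a → (0 : dom P ψ →₀ ℝ) ≤ Finsupp.single z a :=
      fun z a ha => Finsupp.single_nonneg.2 ha
    have hgx0 : g (Finsupp.single ⟨x0, hxd⟩ 1) < 0 := by
      have := hgn (Finsupp.single ⟨y0, hyd⟩ 1 + Finsupp.single ⟨x0, hxd⟩ q)
        (add_nonneg (hs _ _ zero_le_one) (hs _ _ hq.le)) (by
          rw [meas_add (hs _ _ zero_le_one) (hs _ _ hq.le), meas_single, meas_single]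
          simpa using hn)
      rw [map_add, hg1, hgs ⟨x0, hxd⟩ q] at this
      by_contra hc
      push Not at hc
      have := mul_nonneg hq.le hc
      linarith
    have trick := fun {n : ℕ} [NeZero n] (a : Fin n → dom P ψ) => h.trick g hgx0 hg1 hgp hgn a
    let ℓ : ℝ → ℝ := fun z => if hz : z ∈ dom P ψ then g (Finsupp.single ⟨z, hz⟩ 1) else 0
    have hl : ∀ z (hz : z ∈ dom P ψ), ℓ z = g (Finsupp.single ⟨z, hz⟩ 1) := fun z hz => by
      simp [ℓ, hz]
    have hmono : ∀ a ∈ dom P ψ, ∀ b ≤ a, ℓ b ≤ ℓ a := by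
      intro a ha b hb
      have hbd := h.dom_down ha hb
      rw [hl a ha, hl b hbd]
      have := trick (n := 1) (fun _ => ⟨a, ha⟩) ⟨b, hbd⟩ (by simpa using hb)
      simpa using this
    have hconv' : ∀ a ∈ dom P ψ, ∀ b ∈ dom P ψ, b ≤ a → ∀ l ∈ Set.Ioo (0 : ℝ) 1,
        ℓ (l * a + (1 - l) * b) ≤ l * ℓ a + (1 - l) * ℓ b := by
      intro a ha b hb hba l hl01
      have hcd : l * a + (1 - l) * b ∈ dom P ψ := h.dom_down ha (by nlinarith [hl01.1, hl01.2])
      have hba' := hmono a ha b hba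
      have key : ∀ n : ℕ, 0 < n →
          n * (ℓ (l * a + (1 - l) * b) - (l * ℓ a + (1 - l) * ℓ b)) ≤ ℓ a - ℓ b := by
        intro n hnp
        have : NeZero n := ⟨hnp.ne'⟩
        set j := ⌈l * n⌉₊ with hj
        have hj1 : l * n ≤ j := Nat.le_ceil _
        have hnr : (0 : ℝ) < n := by exact_mod_cast hnp
        have hj2 : (j : ℝ) < l * n + 1 := Nat.ceil_lt_add_one (mul_nonneg hl01.1.le hnr.le)
        have hjn : j ≤ n := Nat.ceil_le.2 (by nlinarith [hl01.2])
        have hcard : (Finset.univ.filter fun i : Fin n => (i : ℕ) < j).card = j := by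
          rw [Fin.card_filter_val_lt]; exact min_eq_right hjn
        have hcard2 : ((Finset.univ.filter fun i : Fin n => ¬ (i : ℕ) < j).card : ℝ) = n - j := by
          have := Finset.card_filter_add_card_filter_not (s := (Finset.univ : Finset (Fin n))) (fun i : Fin n => (i : ℕ) < j)
          rw [hcard, Finset.card_univ, Fintype.card_fin] at this
          have h2 : (j : ℝ) + ((Finset.univ.filter fun i : Fin n => ¬ (i : ℕ) < j).card : ℝ) = n := by
            exact_mod_cast this
          linarith
        have hsum : ∀ u v : ℝ, ∑ i : Fin n, (if (i : ℕ) < j then u else v) = j * u + (n - j) * v := by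
          intro u v
          rw [Finset.sum_ite, Finset.sum_const, Finset.sum_const, hcard, nsmul_eq_mul, nsmul_eq_mul,
            hcard2]
        have ht := trick (n := n) (fun i => if (i : ℕ) < j then ⟨a, ha⟩ else ⟨b, hb⟩) ⟨_, hcd⟩ (by
          have e : ∀ i : Fin n, ((if (i : ℕ) < j then (⟨a, ha⟩ : dom P ψ) else ⟨b, hb⟩ : dom P ψ) : ℝ)
              = if (i : ℕ) < j then a else b := by
            intro i; split_ifs <;> rfl
          simp_rw [e]
          rw [hsum]
          nlinarith)
        have e : ∀ i : Fin n, g (Finsupp.single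
            (if (i : ℕ) < j then (⟨a, ha⟩ : dom P ψ) else ⟨b, hb⟩ : dom P ψ) 1)
              = if (i : ℕ) < j then ℓ a else ℓ b := by
          intro i; rw [hl a ha, hl b hb]; split_ifs <;> rfl
        simp_rw [e] at ht
        rw [hsum, ← hl _ hcd] at ht
        nlinarith
      by_contra hlt
      push Not at hlt
      obtain ⟨n, hn⟩ := exists_nat_gt ((ℓ a - ℓ b) /
        (ℓ (l * a + (1 - l) * b) - (l * ℓ a + (1 - l) * ℓ b)))
      have hnp : 0 < n := by
        have : (0 : ℝ) < n := lt_of_le_of_lt (div_nonneg (by linarith) (by linarith)) hn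
        exact_mod_cast this
      rw [div_lt_iff₀ (by linarith)] at hn
      linarith [key n hnp]
    have hInt : ∀ Y : Ω → ℝ, Bd P Y → (range Y).Finite → (∀ᵐ ω ∂P, Y ω ∈ dom P ψ) →
        (ψ Y ≤ 0 → ∫ ω, ℓ (Y ω) ∂P ≤ 0) ∧ (0 < ψ Y → 0 ≤ ∫ ω, ℓ (Y ω) ∂P) := by
      intro Y hY hf hD
      let Y1 : Ω → ℝ := fun ω => if Y ω ∈ dom P ψ then Y ω else 0
      have hY1f : (range Y1).Finite := by
        refine (hf.image (fun y => if y ∈ dom P ψ then y else 0)).subset ?_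
        rintro _ ⟨ω, rfl⟩
        exact ⟨Y ω, ⟨ω, rfl⟩, rfl⟩
      have hdm : MeasurableSet (dom P ψ) := by
        refine OrdConnected.measurableSet ?_
        refine ⟨fun a _ b hb c hc => h.dom_down hb hc.2⟩
      have hY1m : Measurable Y1 := Measurable.ite (hY.1 hdm) hY.1 measurable_const
      have heq : ∀ᵐ ω ∂P, Y ω = Y1 ω := by
        filter_upwards [hD] with ω hω
        simp [Y1, hω]
      have hY1 : Bd P Y1 := by
        obtain ⟨_, K, hK⟩ := hY
        refine ⟨hY1m, K, ?_⟩
        filter_upwards [hK, heq] with ω h1 h2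
        rw [← h2]; exact h1
      have hY1D : ∀ ω, Y1 ω ∈ dom P ψ := by
        intro ω
        by_cases hh : Y ω ∈ dom P ψ
        · simp [Y1, hh]
        · simp only [Y1, hh, if_false]; exact Or.inl le_rfl
      rw [h.ae_eq hY hY1 heq]
      obtain ⟨w, hw, hwm, hwi⟩ := law_meas (P := P) hY1m hY1f hY1D
      have hI : ∫ ω, ℓ (Y ω) ∂P = g w := by
        rw [← hwi g]
        refine integral_congr_ae ?_
        filter_upwards [heq] with ω hω
        rw [← hl, hω]
      rw [hI]
      constructor
      · intro hψ
        exact hgn w hw ⟨Y1, hY1, 1, one_pos, by simp [hwm], hψ⟩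
      · intro hψ
        exact hgp w hw ⟨Y1, hY1, 1, one_pos, by simp [hwm], hψ⟩
    refine ⟨dom P ψ, ℓ, x0, ?_⟩
    refine ⟨fun x hx => Or.inl hx, fun a ha b hb => h.dom_down ha hb, hmono, ?_, ?_, hx0.le, ?_,
      fun Y hY hf hψ => h.ae_dom hY hf hψ, fun Y hY hf hD => (hInt Y hY hf hD).1,
      fun Y hY hf hD => (hInt Y hY hf hD).2⟩
    · intro a ha b hb l hl01
      rcases le_total b a with hba | hba
      · exact hconv' a ha b hb hba l hl01
      · have := hconv' b hb a ha hba (1 - l) ⟨by linarith [hl01.2], by linarith [hl01.1]⟩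
        rw [sub_sub_cancel] at this
        rw [add_comm (l * a), add_comm (l * ℓ a)]
        exact this
    · intro x hx
      have hxd : x ∈ dom P ψ := Or.inl hx
      rw [hl x hxd]
      refine hgn _ (hs _ _ zero_le_one) ?_
      rw [meas_single]
      simpa using h.neg_dirac hx
    · rw [hl x0 hxd]; exact hgx0
  · push Not at hcase
    refine ⟨Iic 0, fun _ => -1, 0, Subset.rfl, fun a ha b hb => le_trans hb ha, ?_, ?_, ?_, le_rfl, ?_,
      ?_, ?_, ?_⟩
    · intros; exact le_rfl
    · intros; linarith
    · intros; norm_num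
    · norm_num
    · intro Y hY hf hψ
      filter_upwards [h.ae_dom hY hf hψ] with ω hω using hcase _ hω
    · intros; simp
    · intro Y hY hf hD hψ
      exfalso
      have := h.mono Y (fun _ => 0) hY (bd_const 0) hD
      rw [h.zero] at this
      linarith

end ell

section expect

variable {P : Measure Ω} [IsProbabilityMeasure P] {ψ : (Ω → ℝ) → ℝ}

lemma erealToENNReal_eq (x : EReal) : erealToENNReal x = x.toENNReal := rfl

lemma eexp_mono {f g : Ω → EReal} (h : ∀ᵐ ω ∂P, f ω ≤ g ω) : eexp P f ≤ eexp P g := by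
  unfold eexp
  refine EReal.sub_le_sub ?_ ?_
  · refine EReal.coe_ennreal_le_coe_ennreal_iff.2 (lintegral_mono_ae ?_)
    filter_upwards [h] with ω hω
    exact EReal.toENNReal_le_toENNReal hω
  · refine EReal.coe_ennreal_le_coe_ennreal_iff.2 (lintegral_mono_ae ?_)
    filter_upwards [h] with ω hω
    exact EReal.toENNReal_le_toENNReal (EReal.neg_le_neg_iff.2 hω)

lemma eexp_coe {g : Ω → ℝ} (hg : Integrable g P) :
    eexp P (fun ω => (g ω : EReal)) = ((∫ ω, g ω ∂P : ℝ) : EReal) := by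
  have h1 : ∀ x : ℝ, erealToENNReal (x : EReal) = ENNReal.ofReal x := fun x => by
    simp [erealToENNReal]
  have h2 : ∀ x : ℝ, erealToENNReal (-(x : EReal)) = ENNReal.ofReal (-x) := fun x => by
    rw [← EReal.coe_neg, h1]
  unfold eexp
  simp_rw [h1, h2]
  rw [integral_eq_lintegral_pos_part_sub_lintegral_neg_part hg, EReal.coe_sub]
  have f1 : ∫⁻ ω, ENNReal.ofReal (g ω) ∂P ≠ ⊤ := hg.lintegral_lt_top.ne
  have f2 : ∫⁻ ω, ENNReal.ofReal (-g ω) ∂P ≠ ⊤ := hg.neg.lintegral_lt_top.ne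
  rw [EReal.coe_ennreal_toReal f1, EReal.coe_ennreal_toReal f2]

lemma simple_integrable {Y : Ω → ℝ} (hY : Measurable Y) (hf : (range Y).Finite) (φ : ℝ → ℝ) :
    Integrable (fun ω => φ (Y ω)) P := by
  let s : SimpleFunc Ω ℝ := ⟨Y, fun x => hY (measurableSet_singleton x), hf⟩
  exact (s.map φ).integrable_of_isFiniteMeasure

lemma approx {Y : Ω → ℝ} (hY : Bd P Y) {ε : ℝ} (hε : 0 < ε) :
    ∃ Z : Ω → ℝ, Bd P Z ∧ (range Z).Finite ∧ ∀ᵐ ω ∂P, Y ω ≤ Z ω ∧ Z ω ≤ Y ω + ε := by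
  obtain ⟨hm, K, hK⟩ := hY
  let c : Ω → ℝ := fun ω => max (-K) (min K (Y ω))
  have hc : Measurable c := measurable_const.max (measurable_const.min hm)
  let Z : Ω → ℝ := fun ω => ε * (⌈c ω / ε⌉ : ℤ)
  have hZm : Measurable Z := by
    have h1 : Measurable fun ω => ⌈c ω / ε⌉ := (hc.div_const ε).ceil
    exact ((measurable_from_top (f := fun n : ℤ => (n : ℝ))).comp h1).const_mul ε
  have hb : ∀ᵐ ω ∂P, Y ω ≤ Z ω ∧ Z ω ≤ Y ω + ε := by
    filter_upwards [hK] with ω hω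
    have hcY : c ω = Y ω := by
      have := abs_le.1 hω
      simp only [c]
      rw [min_eq_right this.2, max_eq_right this.1]
    have h1 := Int.le_ceil (c ω / ε)
    have h2 := Int.ceil_lt_add_one (c ω / ε)
    rw [div_le_iff₀ hε] at h1
    have h3 : Z ω ≤ ε * (c ω / ε + 1) := mul_le_mul_of_nonneg_left h2.le hε.le
    rw [mul_add, mul_div_cancel₀ _ hε.ne', hcY, mul_one] at h3
    refine ⟨?_, h3⟩
    rw [← hcY]
    simp only [Z]
    linarith
  refine ⟨Z, ⟨hZm, K + ε, ?_⟩, ?_, hb⟩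
  · filter_upwards [hb, hK] with ω h1 h2
    have := abs_le.1 h2
    refine abs_le.2 ⟨by linarith, by linarith⟩
  · refine ((Set.finite_Icc ⌈(-K) / ε⌉ ⌈max (-K) K / ε⌉).image (fun n : ℤ => ε * (n : ℝ))).subset ?_
    rintro _ ⟨ω, rfl⟩
    refine ⟨⌈c ω / ε⌉, ⟨?_, ?_⟩, rfl⟩
    · refine Int.ceil_le_ceil (div_le_div_of_nonneg_right (le_max_left _ _) hε.le)
    · refine Int.ceil_le_ceil (div_le_div_of_nonneg_right ?_ hε.le)
      exact max_le_max le_rfl (min_le_left _ _)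

end expect

section phi

open Classical in
/-- The extended loss function. -/
def lossF (D : Set ℝ) (ℓ : ℝ → ℝ) (t : ℝ) : EReal := if t ∈ D then ((1 + ℓ t : ℝ) : EReal) else ⊤

/-- The Orlicz function. -/
def phi (D : Set ℝ) (ℓ : ℝ → ℝ) (x : ℝ) : EReal :=
  ⨆ y : Set.Ioo (0 : ℝ) x, lossF D ℓ (Real.log (y : ℝ))

variable {P : Measure Ω} [IsProbabilityMeasure P] {ψ : (Ω → ℝ) → ℝ} {D : Set ℝ} {ℓ : ℝ → ℝ} {x0 : ℝ}

lemma lossF_mem {t : ℝ} (ht : t ∈ D) : lossF D ℓ t = ((1 + ℓ t : ℝ) : EReal) := by simp [lossF, ht]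

lemma lossF_not {t : ℝ} (ht : t ∉ D) : lossF D ℓ t = ⊤ := by simp [lossF, ht]

lemma lossF_ne_bot (t : ℝ) : lossF D ℓ t ≠ ⊥ := by
  by_cases ht : t ∈ D
  · rw [lossF_mem ht]; exact EReal.coe_ne_bot _
  · rw [lossF_not ht]; exact top_ne_bot

lemma EllData.lossF_mono (e : EllData P ψ D ℓ x0) {a b : ℝ} (hab : a ≤ b) :
    lossF D ℓ a ≤ lossF D ℓ b := by
  by_cases hb : b ∈ D
  · rw [lossF_mem hb, lossF_mem (e.down b hb a hab), EReal.coe_le_coe_iff]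
    linarith [e.mono b hb a hab]
  · rw [lossF_not hb]; exact le_top

lemma EllData.phi_le (e : EllData P ψ D ℓ x0) (t : ℝ) : phi D ℓ (Real.exp t) ≤ lossF D ℓ t := by
  refine iSup_le fun y => e.lossF_mono ?_
  exact ((Real.log_lt_iff_lt_exp y.2.1).2 y.2.2).le

lemma le_phi {s x : ℝ} (hx : Real.exp s < x) : lossF D ℓ s ≤ phi D ℓ x := by
  have := le_iSup (fun y : Set.Ioo (0 : ℝ) x => lossF D ℓ (Real.log (y : ℝ)))
    ⟨Real.exp s, Real.exp_pos s, hx⟩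
  simp only [Real.log_exp] at this
  exact this

lemma le_phi' {s x : ℝ} (hx : 0 < x) (hs : s < Real.log x) : lossF D ℓ s ≤ phi D ℓ x :=
  le_phi ((Real.lt_log_iff_exp_lt hx).1 hs)

lemma phi_ne_bot {x : ℝ} (hx : 0 < x) : phi D ℓ x ≠ ⊥ := by
  have h := le_phi' (D := D) (ℓ := ℓ) (s := Real.log x - 1) hx (by linarith)
  intro h0
  rw [h0] at h
  exact lossF_ne_bot _ (le_bot_iff.1 h)

lemma phi_mono {x y : ℝ} (hxy : x ≤ y) : phi D ℓ x ≤ phi D ℓ y := by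
  refine iSup_le fun z => ?_
  exact le_iSup (fun y : Set.Ioo (0 : ℝ) y => lossF D ℓ (Real.log (y : ℝ)))
    ⟨z, z.2.1, z.2.2.trans_le hxy⟩

lemma phi_left (x : ℝ) : phi D ℓ x = ⨆ y : Set.Ioo (0 : ℝ) x, phi D ℓ (y : ℝ) := by
  refine le_antisymm (iSup_le fun y => ?_) (iSup_le fun y => phi_mono y.2.2.le)
  obtain ⟨z, hz1, hz2⟩ := exists_between y.2.2
  refine le_trans ?_ (le_iSup (fun y : Set.Ioo (0 : ℝ) x => phi D ℓ (y : ℝ))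
    ⟨z, y.2.1.trans hz1, hz2⟩)
  exact le_phi' (y.2.1.trans hz1) (Real.log_lt_log y.2.1 hz1)

lemma EllData.phi_le_one (e : EllData P ψ D ℓ x0) {x : ℝ} (hx : x ≤ 1) : phi D ℓ x ≤ 1 := by
  refine iSup_le fun y => ?_
  have h0 : Real.log (y : ℝ) ≤ 0 := Real.log_nonpos y.2.1.le (y.2.2.le.trans hx)
  rw [lossF_mem (e.zero_mem h0), ← EReal.coe_one, EReal.coe_le_coe_iff]
  linarith [e.nonpos _ h0]

lemma EllData.one_lt_phi (h : PsiData P ψ) (e : EllData P ψ D ℓ x0) {x : ℝ} (hx : 1 < x) :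
    1 < phi D ℓ x := by
  have hl : 0 < Real.log x := Real.log_pos hx
  set s := Real.log x / 2 with hs
  refine lt_of_lt_of_le ?_ (le_phi' (s := s) (by linarith) (by linarith))
  by_cases hsD : s ∈ D
  · rw [lossF_mem hsD, ← EReal.coe_one, EReal.coe_lt_coe_iff]
    have hsp : 0 < s := by linarith
    have hD2 : s / 2 ∈ D := e.down s hsD _ (by linarith)
    have h1 := e.int_pos (fun _ => s / 2) (bd_const _)
      ((Set.finite_singleton (s / 2)).subset (by rintro _ ⟨_, rfl⟩; rfl))
      (Eventually.of_forall fun _ => hD2) (by rw [h.const]; linarith)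
    simp only [integral_const, probReal_univ, one_smul] at h1
    have hx0 := e.x0_le
    have hd : 0 < s - x0 := by linarith
    have h2 := e.conv x0 (e.zero_mem hx0) s hsD ((s / 2) / (s - x0))
      ⟨by positivity, by rw [div_lt_one hd]; linarith⟩
    have e1 : (s / 2) / (s - x0) * x0 + (1 - (s / 2) / (s - x0)) * s = s / 2 := by
      field_simp; ring
    rw [e1] at h2
    by_contra hc
    have hc' : ℓ s ≤ 0 := by linarith
    have h3 : (s / 2) / (s - x0) * ℓ x0 < 0 := mul_neg_of_pos_of_neg (by positivity) e.x0_neg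
    have h4 : 0 ≤ 1 - (s / 2) / (s - x0) := by
      rw [sub_nonneg, div_le_one hd]; linarith
    have h5 := mul_nonpos_of_nonneg_of_nonpos h4 hc'
    linarith
  · rw [lossF_not hsD]
    exact EReal.coe_lt_top 1

lemma le_eadd (a b : EReal) : a + b ≤ eadd a b := by
  unfold eadd
  split_ifs
  · exact le_top
  · exact le_rfl

lemma mul_ne_bot' {l : ℝ} (hl : 0 < l) {a : EReal} (ha : a ≠ ⊥) : (l : EReal) * a ≠ ⊥ := by
  induction a with
  | bot => exact absurd rfl ha
  | top => rw [EReal.coe_mul_top_of_pos hl]; exact top_ne_bot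
  | coe a => rw [← EReal.coe_mul]; exact EReal.coe_ne_bot _

lemma EllData.phi_conv (e : EllData P ψ D ℓ x0) {x y : ℝ} (hx : 0 < x) (hy : 0 < y) {l : ℝ}
    (hl : l ∈ Set.Ioo (0 : ℝ) 1) :
    phi D ℓ (x ^ l * y ^ (1 - l)) ≤
      eadd ((l : EReal) * phi D ℓ x) (((1 - l : ℝ) : EReal) * phi D ℓ y) := by
  refine le_trans ?_ (le_eadd _ _)
  have hl1 : 0 < 1 - l := by linarith [hl.2]
  by_cases hX : phi D ℓ x = ⊤
  · rw [hX, EReal.coe_mul_top_of_pos hl.1,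
      EReal.top_add_of_ne_bot (mul_ne_bot' hl1 (phi_ne_bot hy))]
    exact le_top
  by_cases hY : phi D ℓ y = ⊤
  · rw [hY, EReal.coe_mul_top_of_pos hl1,
      EReal.add_top_of_ne_bot (mul_ne_bot' hl.1 (phi_ne_bot hx))]
    exact le_top
  refine iSup_le fun z => ?_
  have hz : Real.log (z : ℝ) < l * Real.log x + (1 - l) * Real.log y := by
    have := Real.log_lt_log z.2.1 z.2.2
    rwa [Real.log_mul (by positivity) (by positivity), Real.log_rpow hx, Real.log_rpow hy] at this
  set s := Real.log (z : ℝ)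
  set ε := l * Real.log x + (1 - l) * Real.log y - s with hε
  have h1 := le_phi' (D := D) (ℓ := ℓ) (s := Real.log x - ε) hx (by linarith)
  have h2 := le_phi' (D := D) (ℓ := ℓ) (s := Real.log y - ε) hy (by linarith)
  have hs : s = l * (Real.log x - ε) + (1 - l) * (Real.log y - ε) := by rw [hε]; ring
  have ha : Real.log x - ε ∈ D := by
    by_contra hc
    rw [lossF_not hc] at h1
    exact hX (top_le_iff.1 h1)
  have hb : Real.log y - ε ∈ D := by
    by_contra hc
    rw [lossF_not hc] at h2
    exact hY (top_le_iff.1 h2)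
  have hsD : s ∈ D := by
    rcases le_total (Real.log x - ε) (Real.log y - ε) with hh | hh
    · exact e.down _ hb _ (by rw [hs]; nlinarith [hl.1])
    · exact e.down _ ha _ (by rw [hs]; nlinarith)
  have hc := e.conv _ ha _ hb l hl
  rw [← hs] at hc
  rw [lossF_mem ha] at h1
  rw [lossF_mem hb] at h2
  rw [lossF_mem hsD]
  have h3 := phi_ne_bot (D := D) (ℓ := ℓ) hx
  have h4 := phi_ne_bot (D := D) (ℓ := ℓ) hy
  revert h1 h2 h3 h4 hX hY
  generalize phi D ℓ x = u
  generalize phi D ℓ y = v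
  intro hX hY h1 h2 h3 h4
  lift u to ℝ using ⟨hX, h3⟩
  lift v to ℝ using ⟨hY, h4⟩
  rw [EReal.coe_le_coe_iff] at h1 h2
  rw [← EReal.coe_mul, ← EReal.coe_mul, ← EReal.coe_add, EReal.coe_le_coe_iff]
  have h5 := mul_le_mul_of_nonneg_left h1 hl.1.le
  have h6 := mul_le_mul_of_nonneg_left h2 hl1.le
  linarith

lemma EllData.caseA (h : PsiData P ψ) (e : EllData P ψ D ℓ x0) {Y0 : Ω → ℝ} (hY0 : Bd P Y0) {m : ℝ}
    (hm : ψ Y0 < m) {f : Ω → EReal} (hf : ∀ᵐ ω ∂P, f ω ≤ phi D ℓ (Real.exp (Y0 ω - m))) :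
    eexp P f ≤ 1 := by
  obtain ⟨Z, hZ, hZf, hZb⟩ := approx hY0 (sub_pos.2 hm)
  let Y : Ω → ℝ := fun ω => Z ω + (-m)
  have hY : Bd P Y := bd_add hZ (bd_const _)
  have hYf : (range Y).Finite := by
    refine (hZf.image (fun z => z + (-m))).subset ?_
    rintro _ ⟨ω, rfl⟩
    exact ⟨Z ω, ⟨ω, rfl⟩, rfl⟩
  have hψ : ψ Y ≤ 0 := by
    have h1 := h.mono Z (fun ω => Y0 ω + (m - ψ Y0)) hZ (bd_add hY0 (bd_const _))
      (hZb.mono fun ω hω => hω.2)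
    rw [h.cash Y0 hY0] at h1
    have h2 := h.cash Z hZ (-m)
    change ψ (fun ω => Z ω + (-m)) ≤ 0
    linarith
  have hD := e.ae_dom Y hY hYf hψ
  have hi := e.int_neg Y hY hYf hD hψ
  have hInt : Integrable (fun ω => 1 + ℓ (Y ω)) P := simple_integrable hY.1 hYf (fun y => 1 + ℓ y)
  refine (eexp_mono (g := fun ω => ((1 + ℓ (Y ω) : ℝ) : EReal)) ?_).trans ?_
  · filter_upwards [hf, hZb, hD] with ω h1 h2 h3
    rw [← lossF_mem h3]
    refine h1.trans ((e.phi_le _).trans (e.lossF_mono ?_))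
    have := h2.1
    simp only [Y]
    linarith
  · rw [eexp_coe hInt, ← EReal.coe_one, EReal.coe_le_coe_iff,
      integral_add (integrable_const _) (simple_integrable hY.1 hYf ℓ)]
    simp only [integral_const, probReal_univ, one_smul]
    linarith

lemma EllData.caseB (h : PsiData P ψ) (e : EllData P ψ D ℓ x0) {Y0 : Ω → ℝ} (hY0 : Bd P Y0) {m : ℝ}
    (hm : m < ψ Y0) {f : Ω → EReal} (hf : ∀ᵐ ω ∂P, phi D ℓ (Real.exp (Y0 ω - m)) ≤ f ω) :
    ¬ eexp P f ≤ 1 := by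
  classical
  set δ := (ψ Y0 - m) / 4 with hδ
  have hδp : 0 < δ := by rw [hδ]; linarith
  obtain ⟨Z, hZ, hZf, hZb⟩ := approx hY0 hδp
  let Y : Ω → ℝ := fun ω => Z ω + (-2 * δ - m)
  have hY : Bd P Y := bd_add hZ (bd_const _)
  have hYf : (range Y).Finite := by
    refine (hZf.image (fun z => z + (-2 * δ - m))).subset ?_
    rintro _ ⟨ω, rfl⟩
    exact ⟨Z ω, ⟨ω, rfl⟩, rfl⟩
  have hψ : δ < ψ Y := by
    have h1 := h.mono Y0 Z hY0 hZ (hZb.mono fun ω hω => hω.1)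
    have h2 := h.cash Z hZ (-2 * δ - m)
    change δ < ψ (fun ω => Z ω + (-2 * δ - m))
    linarith
  have hfY : ∀ᵐ ω ∂P, lossF D ℓ (Y ω) ≤ f ω := by
    filter_upwards [hf, hZb] with ω h1 h2
    refine le_trans (le_phi ?_) h1
    rw [Real.exp_lt_exp]
    have := h2.2
    simp only [Y]
    linarith
  have main : ∃ φ : ℝ → ℝ, (∀ y, (φ y : EReal) ≤ lossF D ℓ y) ∧ 1 < ∫ ω, φ (Y ω) ∂P := by
    by_cases hD : ∀ᵐ ω ∂P, Y ω ∈ D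
    · refine ⟨fun y => if y ∈ D then 1 + ℓ y else 0, ?_, ?_⟩
      · intro y
        by_cases hy : y ∈ D
        · simp [hy, lossF_mem hy]
        · rw [lossF_not hy]; exact le_top
      · have hI : ∫ ω, (if Y ω ∈ D then 1 + ℓ (Y ω) else 0) ∂P = ∫ ω, (1 + ℓ (Y ω)) ∂P := by
          refine integral_congr_ae ?_
          filter_upwards [hD] with ω hω
          simp [hω]
        rw [hI, integral_add (integrable_const _) (simple_integrable hY.1 hYf ℓ)]
        simp only [integral_const, probReal_univ, one_smul]
        let Y' : Ω → ℝ := fun ω => Y ω + (-δ)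
        have hY' : Bd P Y' := bd_add hY (bd_const _)
        have hYf' : (range Y').Finite := by
          refine (hYf.image (fun z => z + (-δ))).subset ?_
          rintro _ ⟨ω, rfl⟩
          exact ⟨Y ω, ⟨ω, rfl⟩, rfl⟩
        have hD' : ∀ᵐ ω ∂P, Y' ω ∈ D := by
          filter_upwards [hD] with ω hω
          exact e.down _ hω _ (by simp only [Y']; linarith)
        have hψ' : 0 < ψ Y' := by
          have := h.cash Y hY (-δ)
          change 0 < ψ (fun ω => Y ω + (-δ))
          linarith
        have hi := e.int_pos Y' hY' hYf' hD' hψ'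
        obtain ⟨_, K, hK⟩ := id hY
        set R := δ + |K| + |x0| with hR
        have hRp : 0 < R + 1 := by positivity
        set θ := δ / (R + 1) with hθ
        have hθ0 : 0 < θ := by positivity
        have hθ1 : θ < 1 := by
          rw [hθ, div_lt_one hRp]
          have := abs_nonneg K
          have := abs_nonneg x0
          linarith
        have hx0D : x0 ∈ D := e.zero_mem e.x0_le
        have hle : ∀ᵐ ω ∂P, ℓ (Y' ω) ≤ θ * ℓ x0 + (1 - θ) * ℓ (Y ω) := by
          filter_upwards [hD, hK] with ω h1 h2
          refine le_trans ?_ (e.conv x0 hx0D _ h1 θ ⟨hθ0, hθ1⟩)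
          refine e.mono _ ?_ _ ?_
          · rcases le_total x0 (Y ω) with hh | hh
            · exact e.down _ h1 _ (by nlinarith)
            · exact e.down _ hx0D _ (by nlinarith)
          · have h3 : Y ω - x0 ≤ R + 1 := by
              have := le_abs_self (Y ω)
              have := le_abs_self K
              have := neg_abs_le x0
              linarith
            have h4 := mul_le_mul_of_nonneg_left h3 hθ0.le
            have h5 : θ * (R + 1) = δ := by rw [hθ]; field_simp
            simp only [Y']
            nlinarith
        have hi2 := integral_mono_ae (simple_integrable (P := P) hY'.1 hYf' ℓ)
          (simple_integrable (P := P) hY.1 hYf (fun y => θ * ℓ x0 + (1 - θ) * ℓ y)) hle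
        rw [integral_add (integrable_const _)
          ((simple_integrable (P := P) hY.1 hYf ℓ).const_mul _),
          integral_const_mul (1 - θ) (fun ω => ℓ (Y ω))] at hi2
        simp only [integral_const, probReal_univ, one_smul] at hi2
        have h6 : θ * ℓ x0 < 0 := mul_neg_of_pos_of_neg hθ0 e.x0_neg
        have h7 : 0 < (1 - θ) * ∫ ω, ℓ (Y ω) ∂P := by linarith
        have h8 := pos_of_mul_pos_right h7 (by linarith)
        linarith
    · have hp0 : P {ω | ¬ Y ω ∈ D} ≠ 0 := fun h0 => hD (ae_iff.2 h0)
      have hp : 0 < P.real {ω | ¬ Y ω ∈ D} := ENNReal.toReal_pos hp0 (measure_ne_top _ _)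
      set p := P.real {ω | ¬ Y ω ∈ D} with hpdef
      have hDm : MeasurableSet D :=
        OrdConnected.measurableSet ⟨fun a _ b hb c hc => e.down b hb c hc.2⟩
      set I := ∫ ω, (if Y ω ∈ D then 1 + ℓ (Y ω) else 0) ∂P with hI
      refine ⟨fun y => (if y ∈ D then 1 + ℓ y else 0) + (if y ∈ D then 0 else (2 - I) / p), ?_, ?_⟩
      · intro y
        by_cases hy : y ∈ D
        · simp [hy, lossF_mem hy]
        · rw [lossF_not hy]; exact le_top
      · rw [integral_add (simple_integrable (P := P) hY.1 hYf (fun y => if y ∈ D then 1 + ℓ y else 0))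
          (simple_integrable (P := P) hY.1 hYf (fun y => if y ∈ D then 0 else (2 - I) / p)), ← hI]
        have h1 : ∫ ω, (if Y ω ∈ D then 0 else (2 - I) / p) ∂P = 2 - I := by
          have h2 : ∀ ω, (if Y ω ∈ D then 0 else (2 - I) / p) =
              {ω | ¬ Y ω ∈ D}.indicator (fun _ => (2 - I) / p) ω := by
            intro ω
            by_cases hy : Y ω ∈ D <;> simp [hy]
          simp_rw [h2]
          rw [integral_indicator_const _ (show MeasurableSet {ω | ¬ Y ω ∈ D} from hY.1 hDm.compl), smul_eq_mul, ← hpdef]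
          field_simp
        rw [h1]
        linarith
  obtain ⟨φ, hφ1, hφ2⟩ := main
  have h1 : eexp P (fun ω => ((φ (Y ω) : ℝ) : EReal)) ≤ eexp P f :=
    eexp_mono (hfY.mono fun ω hω => (hφ1 _).trans hω)
  rw [eexp_coe (simple_integrable hY.1 hYf φ)] at h1
  rw [not_le]
  refine lt_of_lt_of_le ?_ h1
  rw [← EReal.coe_one, EReal.coe_lt_coe_iff]
  exact hφ2

end phi

section final

variable {P : Measure Ω} [IsProbabilityMeasure P]

lemma mem_exp {X : Ω → ℝ} (hX : Bd P X) : MemLinftyPlusPlus P (fun ω => Real.exp (X ω)) := by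
  obtain ⟨hm, K, hK⟩ := hX
  refine ⟨Real.measurable_exp.comp hm, ⟨Real.exp (-K), Real.exp_pos _, ?_⟩, Real.exp K, ?_⟩
  · filter_upwards [hK] with ω hω
    exact Real.exp_le_exp.2 (abs_le.1 hω).1
  · filter_upwards [hK] with ω hω
    exact Real.exp_le_exp.2 (abs_le.1 hω).2

lemma bd_log {X : Ω → ℝ} (hX : MemLinftyPlusPlus P X) : Bd P (fun ω => Real.log (X ω)) := by
  obtain ⟨hm, ⟨c, hc, hcX⟩, C, hC⟩ := hX
  refine ⟨Real.measurable_log.comp hm, |Real.log c| + |Real.log C|, ?_⟩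
  filter_upwards [hcX, hC] with ω h1 h2
  have h3 := Real.log_le_log hc h1
  have h4 := Real.log_le_log (hc.trans_le h1) h2
  have := neg_abs_le (Real.log c)
  have := le_abs_self (Real.log C)
  have := abs_nonneg (Real.log c)
  have := abs_nonneg (Real.log C)
  exact abs_le.2 ⟨by linarith, by linarith⟩

lemma map_exp {X : Ω → ℝ} (hX : Bd P X) :
    P.map (fun ω => Real.exp (X ω)) = (P.map X).map Real.exp :=
  (Measure.map_map Real.measurable_exp hX.1).symm

end final

end OrliczAux

/-- on a nonatomic probability space, every law-invariant geometrically
convex return risk measure on `L∞₊₊` with the CxLS property is a generalized Orlicz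
premium `H_Φ` for some GA-convex Orlicz function `Φ : (0,∞) → ℝ ∪ {+∞}`. -/
theorem ggConvex_returnRiskMeasure_cxls_is_orlicz
    (P : Measure Ω) [IsProbabilityMeasure P]
    (hP : ∀ μ : Measure ℝ, IsProbabilityMeasure μ →
      ∃ X : Ω → ℝ, Measurable X ∧ P.map X = μ)
    (ρ : (Ω → ℝ) → ℝ)
    (hmono : ∀ X Y : Ω → ℝ, MemLinftyPlusPlus P X → MemLinftyPlusPlus P Y →
      (∀ᵐ ω ∂P, X ω ≤ Y ω) → ρ X ≤ ρ Y)
    (hhom : ∀ X : Ω → ℝ, MemLinftyPlusPlus P X → ∀ l : ℝ, 0 < l →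
      ρ (fun ω => l * X ω) = l * ρ X)
    (hnorm : ρ (fun _ => (1 : ℝ)) = 1)
    (hpos : ∀ X : Ω → ℝ, MemLinftyPlusPlus P X → 0 < ρ X)
    (hlawinv : ∀ X Y : Ω → ℝ, MemLinftyPlusPlus P X → MemLinftyPlusPlus P Y →
      P.map X = P.map Y → ρ X = ρ Y)
    (hGG : ∀ X Y : Ω → ℝ, MemLinftyPlusPlus P X → MemLinftyPlusPlus P Y →
      ∀ l ∈ Set.Ioo (0 : ℝ) 1,
        ρ (fun ω => X ω ^ l * Y ω ^ (1 - l)) ≤ ρ X ^ l * ρ Y ^ (1 - l))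
    (hCxLS : ∀ X Y Z : Ω → ℝ, MemLinftyPlusPlus P X → MemLinftyPlusPlus P Y →
      MemLinftyPlusPlus P Z → ∀ γ : ℝ, ρ X = γ → ρ Y = γ →
      ∀ l ∈ Set.Ioo (0 : ℝ) 1,
        P.map Z = ENNReal.ofReal l • P.map X + ENNReal.ofReal (1 - l) • P.map Y →
        ρ Z = γ) :
    ∃ Φ : ℝ → EReal,
      (∀ x : ℝ, 0 < x → Φ x ≠ ⊥) ∧
      (∀ x : ℝ, 0 < x → x ≤ 1 → Φ x ≤ 1) ∧
      (∀ x : ℝ, 1 < x → 1 < Φ x) ∧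
      (∀ x y : ℝ, 0 < x → x ≤ y → Φ x ≤ Φ y) ∧
      (∀ x : ℝ, 0 < x → Φ x = ⨆ y : Set.Ioo (0 : ℝ) x, Φ (y : ℝ)) ∧
      (∀ x y : ℝ, 0 < x → 0 < y → ∀ l ∈ Set.Ioo (0 : ℝ) 1,
        Φ (x ^ l * y ^ (1 - l)) ≤
          eadd ((l : EReal) * Φ x) (((1 - l : ℝ) : EReal) * Φ y)) ∧
      ∀ X : Ω → ℝ, MemLinftyPlusPlus P X →
        ρ X = sInf {k : ℝ | 0 < k ∧ eexp P (fun ω => Φ (X ω / k)) ≤ 1} := by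
  have hψ : OrliczAux.PsiData P (fun X => Real.log (ρ (fun ω => Real.exp (X ω)))) := by
    refine ⟨hP, ?_, ?_, ?_, ?_, ?_, ?_⟩
    · intro X Y hX hY hXY
      refine Real.log_le_log (hpos _ (OrliczAux.mem_exp hX))
        (hmono _ _ (OrliczAux.mem_exp hX) (OrliczAux.mem_exp hY) ?_)
      filter_upwards [hXY] with ω hω using Real.exp_le_exp.2 hω
    · intro X hX c
      have e : (fun ω => Real.exp (X ω + c)) = fun ω => Real.exp c * Real.exp (X ω) := by
        funext ω; rw [Real.exp_add, mul_comm]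
      change Real.log (ρ (fun ω => Real.exp (X ω + c))) = _
      rw [e, hhom _ (OrliczAux.mem_exp hX) _ (Real.exp_pos c),
        Real.log_mul (Real.exp_pos c).ne' (hpos _ (OrliczAux.mem_exp hX)).ne', Real.log_exp, add_comm]
    · simp [hnorm]
    · intro X Y hX hY hXY
      have := hlawinv _ _ (OrliczAux.mem_exp hX) (OrliczAux.mem_exp hY)
        (by rw [OrliczAux.map_exp hX, OrliczAux.map_exp hY, hXY])
      simp only [this]
    · intro X Y hX hY l hl
      have hX1 := hpos _ (OrliczAux.mem_exp hX)
      have hY1 := hpos _ (OrliczAux.mem_exp hY)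
      have h1 := hGG _ _ (OrliczAux.mem_exp hX) (OrliczAux.mem_exp hY) l hl
      have e : (fun ω => Real.exp (X ω) ^ l * Real.exp (Y ω) ^ (1 - l)) =
          fun ω => Real.exp (l * X ω + (1 - l) * Y ω) := by
        funext ω
        rw [← Real.exp_mul, ← Real.exp_mul, ← Real.exp_add]
        congr 1; ring
      rw [e] at h1
      have hb : OrliczAux.Bd P (fun ω => l * X ω + (1 - l) * Y ω) :=
        OrliczAux.bd_add (OrliczAux.bd_mul l hX) (OrliczAux.bd_mul (1 - l) hY)
      have h2 := Real.log_le_log (hpos _ (OrliczAux.mem_exp hb)) h1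
      rw [Real.log_mul (by positivity) (by positivity), Real.log_rpow hX1, Real.log_rpow hY1] at h2
      exact h2
    · intro X Y Z hX hY hZ γ hXγ hYγ l hl hmap
      have hX1 := hpos _ (OrliczAux.mem_exp hX)
      have hY1 := hpos _ (OrliczAux.mem_exp hY)
      have h1 := hCxLS _ _ _ (OrliczAux.mem_exp hX) (OrliczAux.mem_exp hY) (OrliczAux.mem_exp hZ)
        (Real.exp γ) (by rw [← hXγ, Real.exp_log hX1]) (by rw [← hYγ, Real.exp_log hY1]) l hl
        (by
          rw [OrliczAux.map_exp hX, OrliczAux.map_exp hY, OrliczAux.map_exp hZ, hmap,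
            Measure.map_add _ _ Real.measurable_exp, Measure.map_smul, Measure.map_smul])
      change Real.log (ρ (fun ω => Real.exp (Z ω))) = γ
      rw [h1, Real.log_exp]
  obtain ⟨D, ℓ, x0, e⟩ := hψ.exists_ell
  refine ⟨OrliczAux.phi D ℓ, fun x hx => OrliczAux.phi_ne_bot hx, fun x _ hx => e.phi_le_one hx,
    fun x hx => e.one_lt_phi hψ hx, fun x y _ hxy => OrliczAux.phi_mono hxy,
    fun x _ => OrliczAux.phi_left x, fun x y hx hy l hl => e.phi_conv hx hy hl, ?_⟩
  intro X hX
  have hY := OrliczAux.bd_log hX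
  have hXpos : ∀ᵐ ω ∂P, 0 < X ω := by
    obtain ⟨_, ⟨c, hc, hcX⟩, _⟩ := hX
    filter_upwards [hcX] with ω hω using hc.trans_le hω
  have hXe : ρ (fun ω => Real.exp (Real.log (X ω))) = ρ X := by
    refine le_antisymm (hmono _ _ (OrliczAux.mem_exp hY) hX ?_)
      (hmono _ _ hX (OrliczAux.mem_exp hY) ?_)
    · filter_upwards [hXpos] with ω hω using (Real.exp_log hω).le
    · filter_upwards [hXpos] with ω hω using (Real.exp_log hω).ge
  have hρ := hpos X hX
  have hfk : ∀ k : ℝ, 0 < k → ∀ᵐ ω ∂P, OrliczAux.phi D ℓ (X ω / k) =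
      OrliczAux.phi D ℓ (Real.exp (Real.log (X ω) - Real.log k)) := by
    intro k hk
    filter_upwards [hXpos] with ω hω
    rw [Real.exp_sub, Real.exp_log hω, Real.exp_log hk]
  have hin : ∀ k, ρ X < k → k ∈ {k : ℝ | 0 < k ∧
      eexp P (fun ω => OrliczAux.phi D ℓ (X ω / k)) ≤ 1} := by
    intro k hk
    have hk0 := hρ.trans hk
    refine ⟨hk0, e.caseA hψ hY (m := Real.log k) ?_ ((hfk k hk0).mono fun ω hω => hω.le)⟩
    change Real.log (ρ (fun ω => Real.exp (Real.log (X ω)))) < Real.log k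
    rw [hXe]
    exact Real.log_lt_log hρ hk
  have hout : ∀ k ∈ {k : ℝ | 0 < k ∧
      eexp P (fun ω => OrliczAux.phi D ℓ (X ω / k)) ≤ 1}, ρ X ≤ k := by
    rintro k ⟨hk0, hk⟩
    by_contra hlt
    push Not at hlt
    refine e.caseB hψ hY (m := Real.log k) ?_ ((hfk k hk0).mono fun ω hω => hω.ge) hk
    change Real.log k < Real.log (ρ (fun ω => Real.exp (Real.log (X ω))))
    rw [hXe]
    exact Real.log_lt_log hk0 hlt
  refine le_antisymm (le_csInf ⟨ρ X + 1, hin _ (by linarith)⟩ hout) ?_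
  refine le_of_forall_gt_imp_ge_of_dense fun k hk => ?_
  exact csInf_le ⟨ρ X, hout⟩ (hin k hk)
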